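/- arXiv:math/0604368 — 3 statements merged into one kernel-verified Lean document; each statement's English description precedes it below -/
import Mathlib

section
/- Define the intertwining operators φ_i = T_i(Y_iY_{i+1}^{−1} − 1) + (u − u^{−1}) on R (1 ≤ i ≤ n−1). Then: (1) φ_i Y_i = Y_{i+1} φ_i, φ_i Y_{i+1} = Y_i φ_i, and φ_i Y_j = Y_j φ_i for all j ≠ i, i+1 (so φ_i intertwines the Y-action through the simple reflection s_i); (2) φ_i² = (u(Y_iY_{i+1}^{−1} − 1) + (u − u^{−1}))·(u(Y_{i+1}Y_i^{−1} − 1) + (u − u^{−1})). -/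
/-!
The intertwining operators `φᵢ = Tᵢ(Yᵢ Y_{i+1}⁻¹ - 1) + (u - u⁻¹)` of the polynomial
representation of the double affine Hecke algebra intertwine the `Y`-action through the simple
reflections, and satisfy the quadratic relation
`φᵢ² = (u(YᵢY_{i+1}⁻¹ - 1) + (u - u⁻¹))·(u(Y_{i+1}Yᵢ⁻¹ - 1) + (u - u⁻¹))`.
-/

noncomputable section

open scoped BigOperators

/-- The Laurent polynomial ring `K[x₁^{±1}, …, xₙ^{±1}]`. -/
abbrev Laur (K : Type) [Field K] (n : ℕ) : Type := AddMonoidAlgebra K (Fin n → ℤ)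

namespace DAHA

variable (K : Type) [Field K] (n : ℕ)

/-- The Laurent monomial `x_j`. -/
def X (j : Fin n) : Laur K n := AddMonoidAlgebra.single (Pi.single j (1 : ℤ)) (1 : K)

/-- The Laurent monomial `x_j⁻¹`. -/
def Xinv (j : Fin n) : Laur K n := AddMonoidAlgebra.single (Pi.single j (-1 : ℤ)) (1 : K)

/-- The operator family `T`, extended by `1` outside the allowed index range. -/
def Tt (T : ∀ i : ℕ, i + 1 < n → Module.End K (Laur K n)) (i : ℕ) :
    Module.End K (Laur K n) :=
  if h : i + 1 < n then T i h else 1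

/-- The inverse operators `Tᵢ⁻¹ = Tᵢ - u + u⁻¹`, extended by `1`. -/
def Tinvt (u : K) (T : ∀ i : ℕ, i + 1 < n → Module.End K (Laur K n)) (i : ℕ) :
    Module.End K (Laur K n) :=
  if h : i + 1 < n then T i h - (u - u⁻¹) • 1 else 1

/-- The Cherednik operators (0-indexed):
`Y_j = T_j⁻¹ T_{j+1}⁻¹ ⋯ T_{n-2}⁻¹ ∘ ω ∘ T_0 T_1 ⋯ T_{j-1}`. -/
def Yop (u : K) (T : ∀ i : ℕ, i + 1 < n → Module.End K (Laur K n))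
    (ω : Module.End K (Laur K n)) (j : ℕ) : Module.End K (Laur K n) :=
  (((List.range (n - 1 - j)).map fun k => Tinvt K n u T (j + k)).prod) * ω *
    (((List.range j).map fun k => Tt K n T k).prod)


section grp
variable {G : Type*} [Group G]

def prInv (t : ℕ → G) (m : ℕ) : G := ((List.range m).map fun k => (t k)⁻¹).prod

theorem prInv_succ (t : ℕ → G) (m : ℕ) : prInv t (m+1) = prInv t m * (t m)⁻¹ := by
  simp [prInv, List.range_succ]

theorem prInv_succ' (t : ℕ → G) (m : ℕ) :
    prInv t (m+1) = (t 0)⁻¹ * prInv (fun k => t (k+1)) m := by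
  simp [prInv, List.range_succ_eq_map, Function.comp_def]

theorem prInv_comm (t : ℕ → G) (m : ℕ) (g : G) (h : ∀ k < m, Commute g (t k)) :
    Commute g (prInv t m) := by
  induction m with
  | zero => simp [prInv]
  | succ m ih =>
    rw [prInv_succ]
    exact (ih fun k hk => h k (by omega)).mul_right (h m (by omega)).inv_right

theorem br_inv {a b : G} (h : a * b * a = b * a * b) : a * b⁻¹ * a⁻¹ = b⁻¹ * a⁻¹ * b := by
  have : b * a * (a * b⁻¹ * a⁻¹) * (a * b) = b * a * (b⁻¹ * a⁻¹ * b) * (a * b) := by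
    have e : a⁻¹ * (b * a * b) = b * a := by rw [← h]; group
    have e2 : b * a * (b⁻¹ * a⁻¹ * b) * (a * b) = b * a * b⁻¹ * (a⁻¹ * (b * a * b)) := by group
    rw [e2, e]; group
  exact mul_left_cancel (mul_right_cancel this)

/-- `t_i` moved through `t_0⁻¹ ⋯ t_{m-1}⁻¹`. -/
theorem prInv_pass (t : ℕ → G) (m : ℕ)
    (hb : ∀ i, i + 1 < m → t i * t (i+1) * t i = t (i+1) * t i * t (i+1))
    (hc : ∀ i j, i + 1 < j → j < m → Commute (t i) (t j)) (i : ℕ) (hi : i + 1 < m) :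
    t (i+1) * prInv t m = prInv t m * t i := by
  induction m with
  | zero => omega
  | succ m ih =>
    rcases Nat.lt_or_ge (i+1) m with h | h
    · rw [prInv_succ, ← mul_assoc, ih (fun i hi => hb i (by omega)) (fun i j h1 h2 => hc i j h1 (by omega)) h,
        mul_assoc, mul_assoc, ((hc i m h (by omega)).inv_right).eq]
    · obtain rfl : m = i + 1 := by omega
      have h1 : Commute (t (i+1)) (prInv t i) :=
        prInv_comm _ _ _ fun k hk => (hc k (i+1) (by omega) (by omega)).symm
      rw [prInv_succ, prInv_succ]
      calc t (i+1) * (prInv t i * (t i)⁻¹ * (t (i+1))⁻¹)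
          = (t (i+1) * prInv t i) * (t i)⁻¹ * (t (i+1))⁻¹ := by group
        _ = prInv t i * (t (i+1) * (t i)⁻¹ * (t (i+1))⁻¹) := by rw [h1.eq]; group
        _ = _ := by rw [br_inv (hb i (by omega)).symm]; group

theorem prInv_base (t : ℕ → G) (m : ℕ)
    (hb : ∀ i, i < m → t i * t (i+1) * t i = t (i+1) * t i * t (i+1))
    (hc : ∀ i j, i + 1 < j → j ≤ m → Commute (t i) (t j)) :
    t 0 * (prInv (fun k => t (k+1)) m * prInv t m) =
      (prInv (fun k => t (k+1)) m * prInv t m) * t m := by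
  induction m with
  | zero => simp [prInv]
  | succ m ih =>
    have h1 : Commute (t (m+1)) (prInv t m) :=
        prInv_comm _ _ _ fun k hk => (hc k (m+1) (by omega) (by omega)).symm
    have ih' := ih (fun i hi => hb i (by omega)) (fun i j h1 h2 => hc i j h1 (by omega))
    rw [prInv_succ, prInv_succ]
    have e : prInv (fun k => t (k+1)) m * (t (m+1))⁻¹ * (prInv t m * (t m)⁻¹)
        = (prInv (fun k => t (k+1)) m * prInv t m) * ((t (m+1))⁻¹ * (t m)⁻¹) := by
      have := h1.inv_left.eq
      calc _ = prInv (fun k => t (k+1)) m * ((t (m+1))⁻¹ * prInv t m) * (t m)⁻¹ := by group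
        _ = _ := by rw [this]; group
    rw [e, ← mul_assoc, ih', mul_assoc, mul_assoc]
    have := br_inv (hb m (by omega))
    rw [← mul_assoc (t m), this]; group

theorem w_pass (t : ℕ → G) (w : G) (m : ℕ) (h : ∀ k < m, w * t (k+1) = t k * w) :
    w * prInv (fun k => t (k+1)) m = prInv t m * w := by
  induction m with
  | zero => simp [prInv]
  | succ m ih =>
    rw [prInv_succ, prInv_succ, ← mul_assoc, ih fun k hk => h k (by omega), mul_assoc, mul_assoc]
    congr 1
    have := h m (by omega)
    rw [mul_inv_eq_iff_eq_mul, mul_assoc, this]; group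

def Yg (t : ℕ → G) (w : G) (n j : ℕ) : G :=
  ((List.range (n - 1 - j)).map fun k => (t (j + k))⁻¹).prod * w *
    ((List.range j).map fun k => t k).prod

theorem Yg_zero (t : ℕ → G) (w : G) (n : ℕ) : Yg t w n 0 = prInv t (n-1) * w := by
  simp [Yg, prInv]

theorem Yg_succ (t : ℕ → G) (w : G) (n j : ℕ) (hj : j + 1 < n) :
    Yg t w n (j+1) = t j * Yg t w n j * t j := by
  obtain ⟨m, hm⟩ : ∃ m, n - 1 - j = m + 1 := ⟨n - 1 - j - 1, by omega⟩
  have hm' : n - 1 - (j+1) = m := by omega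
  unfold Yg
  rw [hm, hm', List.range_succ_eq_map (n := m), List.range_succ (n := j)]
  simp [Function.comp_def, mul_assoc, add_left_comm, add_comm]

variable (t : ℕ → G) (w : G) (m : ℕ)

theorem Yg_main
    (hb : ∀ i, i + 2 < m + 2 → t i * t (i+1) * t i = t (i+1) * t i * t (i+1))
    (hc : ∀ i j, i + 1 < j → j + 1 < m + 2 → Commute (t i) (t j))
    (hw : ∀ k, k + 2 < m + 2 → w * t (k+1) = t k * w)
    (hw2 : w * w * t 0 = t m * (w * w)) :
    (∀ i j, i + 1 < m + 2 → j < m + 2 → j ≠ i → j ≠ i + 1 → Commute (t i) (Yg t w (m+2) j)) ∧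
    (∀ i, i + 1 < m + 2 → Commute (Yg t w (m+2) i) (Yg t w (m+2) (i+1))) := by
  have A : ∀ j i, i + 1 < m + 2 → j < i → Commute (t i) (Yg t w (m+2) j) := by
    intro j
    induction j with
    | zero =>
      intro i hi hj
      obtain ⟨i, rfl⟩ : ∃ k, i = k + 1 := ⟨i - 1, by omega⟩
      rw [Yg_zero]
      change _ = _
      rw [← mul_assoc, prInv_pass t _ (fun i hi => hb i (by omega))
        (fun i j h1 h2 => hc i j h1 (by omega)) i (by omega), mul_assoc, mul_assoc,
        hw i (by omega)]
    | succ j ih =>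
      intro i hi hj
      rw [Yg_succ _ _ _ _ (by omega)]
      have h1 := (hc j i (by omega) hi).symm
      exact (h1.mul_right (ih i hi (by omega))).mul_right h1
  have B : ∀ j i, j < m + 2 → i + 1 < j → Commute (t i) (Yg t w (m+2) j) := by
    intro j
    induction j with
    | zero => intro i _ h; omega
    | succ j ih =>
      intro i hj hi
      rcases Nat.lt_or_ge (i+1) j with h | h
      · rw [Yg_succ _ _ _ _ (by omega)]
        have h1 := (hc i j (by omega) hj)
        exact (h1.mul_right (ih i (by omega) (by omega))).mul_right h1
      · obtain rfl : j = i + 1 := by omega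
        rw [Yg_succ _ _ _ _ (by omega), Yg_succ _ _ _ _ (by omega)]
        have h1 := (A i (i+1) (by omega) (by omega)).eq
        have h2 := hb i (by omega)
        generalize Yg t w (m+2) i = y at *
        generalize t i = a at *
        generalize t (i+1) = b at *
        change _ = _
        calc a * (b * (a * y * a) * b) = (a * b * a) * y * a * b := by group
          _ = b * a * (b * y) * a * b := by rw [h2]; group
          _ = b * a * y * (b * a * b) := by rw [h1]; group
          _ = _ := by rw [← h2]; group
  refine ⟨fun i j hi hj h1 h2 => ?_, ?_⟩
  · rcases Nat.lt_or_ge j i with h | h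
    · exact A j i hi h
    · exact B j i hj (by omega)
  · intro i
    induction i with
    | zero =>
      intro _
      rw [Yg_succ _ _ _ _ (by omega), Yg_zero, show m + 2 - 1 = m + 1 by omega, prInv_succ']
      have h1 := w_pass t w m fun k hk => hw k (by omega)
      have h2 := prInv_base t m (fun i hi => hb i (by omega))
        (fun i j h1 h2 => hc i j h1 (by omega))
      generalize prInv (fun k => t (k+1)) m = Q at *
      generalize prInv t m = P at *
      change _ = _
      have h3 : t 0 * (Q * w * Q * w) = (Q * w * Q * w) * t 0 := by
        calc t 0 * (Q * w * Q * w) = t 0 * (Q * (w * Q) * w) := by group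
          _ = t 0 * (Q * P) * (w * w) := by rw [h1]; group
          _ = Q * P * (t m * (w * w)) := by rw [h2]; group
          _ = Q * (P * w) * w * t 0 := by rw [← hw2]; group
          _ = _ := by rw [← h1]; group
      calc _ = (t 0)⁻¹ * ((Q * w * Q * w) * t 0) := by group
        _ = Q * w * Q * w := by rw [← h3]; group
        _ = _ := by group
    | succ i ih =>
      intro hi
      have h4 := (ih (by omega)).eq
      rw [Yg_succ _ _ _ (i+1) (by omega)]
      rw [Yg_succ _ _ _ _ (by omega)] at h4 ⊢
      have h1 := (A i (i+1) (by omega) (by omega)).eq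
      have h2 := hb i (by omega)
      generalize Yg t w (m+2) i = y at *
      generalize t i = a at *
      generalize t (i+1) = b at *
      change _ = _
      calc a * y * a * (b * (a * y * a) * b) = a * y * (a * b * a) * y * a * b := by group
        _ = a * (y * b) * a * (b * y) * a * b := by rw [h2]; group
        _ = a * b * y * a * y * (b * a * b) := by rw [← h1]; simp only [mul_assoc]; rw [← mul_assoc b y (a * b), h1]; simp only [mul_assoc]
        _ = a * b * (y * (a * y * a)) * b * a := by rw [← h2]; group
        _ = (a * b * a) * y * a * y * b * a := by rw [h4]; group
        _ = b * a * (b * y) * a * (y * b) * a := by rw [h2]; group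
        _ = b * a * y * (b * a * b) * y * a := by rw [← h1]; simp only [mul_assoc]; rw [← mul_assoc b y, h1]; simp only [mul_assoc]
        _ = _ := by rw [← h2]; group

theorem Yg_comm (n : ℕ)
    (h1 : ∀ i j, i + 1 < n → j < n → j ≠ i → j ≠ i + 1 → Commute (t i) (Yg t w n j))
    (h2 : ∀ i, i + 1 < n → Commute (Yg t w n i) (Yg t w n (i+1))) (j k : ℕ)
    (hj : j < n) (hk : k < n) : Commute (Yg t w n j) (Yg t w n k) := by
  have key : ∀ d j, j + 1 + d < n → Commute (Yg t w n j) (Yg t w n (j + 1 + d)) := by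
    intro d
    induction d with
    | zero => intro j hj; exact h2 j hj
    | succ d ih =>
      intro j hj
      rw [← add_assoc, Yg_succ _ _ _ _ (by omega)]
      have c := (h1 (j+1+d) j (by omega) (by omega) (by omega) (by omega)).symm
      exact (c.mul_right (ih j (by omega))).mul_right c
  rcases lt_trichotomy j k with h | h | h
  · obtain ⟨d, rfl⟩ := Nat.exists_eq_add_of_le (show j + 1 ≤ k from h)
    exact key d j hk
  · rw [h]
  · obtain ⟨d, rfl⟩ := Nat.exists_eq_add_of_le (show k + 1 ≤ j from h)
    exact (key d k hj).symm
end grp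

theorem phi_alg {K E : Type*} [Field K] [Ring E] [Algebra K E] (u : K) (hu : u ≠ 0)
    (T Ti A B A' B' P : E) (hTi : Ti = T - (u - u⁻¹) • (1:E)) (h1 : T * Ti = 1) (h2 : Ti * T = 1)
    (hB : B = T * A * T) (hc : A * B = B * A) (hA1 : A * A' = 1) (hA2 : A' * A = 1)
    (hB1 : B * B' = 1) (hB2 : B' * B = 1) (hP : P = T * (A * B' - 1) + (u - u⁻¹) • (1:E)) :
    P * A = B * P ∧ P * B = A * P ∧
    (∀ Y, T * Y = Y * T → A * Y = Y * A → B * Y = Y * B → P * Y = Y * P) ∧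
    P * P = (u • (A * B' - 1) + (u - u⁻¹) • (1:E)) * (u • (B * A' - 1) + (u - u⁻¹) • (1:E)) := by
  have inv_comm : ∀ {b b' y : E}, b * b' = 1 → b' * b = 1 → b * y = y * b → b' * y = y * b' := by
    intro b b' y e1 e2 e
    calc b' * y = b' * y * (b * b') := by rw [e1, mul_one]
      _ = b' * (y * b) * b' := by noncomm_ring
      _ = (b' * b) * y * b' := by rw [← e]; noncomm_ring
      _ = _ := by rw [e2, one_mul]
  generalize hq : u - u⁻¹ = q at *
  have hTA : T * A = B * T - q • B := by
    calc T * A = T * A * (T * Ti) := by rw [h1, mul_one]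
      _ = B * Ti := by rw [hB]; noncomm_ring
      _ = _ := by rw [hTi]; simp [mul_sub]
  have hTB : T * B = A * T + q • B := by
    have : Ti * B = A * T := by
      rw [hB]; calc _ = (Ti * T) * A * T := by noncomm_ring
        _ = _ := by rw [h2, one_mul]
    rw [hTi] at this
    rw [← this]; simp [sub_mul]
  have hTT : T * T = q • T + 1 := by
    rw [hTi] at h1; rw [← h1]; simp [mul_sub]
  have cB'A : B' * A = A * B' := inv_comm hB1 hB2 hc.symm
  have cA'B : A' * B = B * A' := inv_comm hA1 hA2 hc
  have cB'A' : A' * B' = B' * A' := inv_comm hA1 hA2 cB'A.symm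
  have p1 : P * A = B * P := by
    have e : (A * B' - 1) * A = A * (A * B' - 1) := by
      rw [sub_mul, mul_assoc, cB'A]; noncomm_ring
    have e2 : B * (A * B') = A := by rw [← mul_assoc, ← hc, mul_assoc, hB1, mul_one]
    calc P * A = T * ((A * B' - 1) * A) + q • A := by rw [hP]; simp [add_mul, mul_assoc]
      _ = (T * A) * (A * B' - 1) + q • A := by rw [e]; noncomm_ring
      _ = B * T * (A * B' - 1) - q • (B * (A * B')) + q • B + q • A := by
        rw [hTA]; simp only [sub_mul, mul_sub, mul_one, smul_mul_assoc]; abel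
      _ = B * T * (A * B' - 1) + q • B := by rw [e2]; abel
      _ = _ := by rw [hP]; simp [mul_add, mul_assoc]
  have p2 : P * B = A * P := by
    have e : A * B' * B = A := by rw [mul_assoc, hB2, mul_one]
    have e2 : B * (A * B') = A := by rw [← mul_assoc, ← hc, mul_assoc, hB1, mul_one]
    have l : P * B = T * A - T * B + q • B := by
      rw [hP]; simp only [add_mul, smul_mul_assoc, one_mul, mul_assoc, sub_mul, hB2, mul_one, mul_sub]
    have hAT : A * T = T * B - q • B := by rw [hTB]; simp
    have r : A * P = T * (B * (A * B')) - q • (B * (A * B')) - T * B + q • B + q • A := by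
      rw [hP, mul_add, ← mul_assoc, hAT]
      simp only [sub_mul, mul_sub, mul_one, smul_mul_assoc, mul_smul_comm, mul_assoc]; abel
    rw [l, r, e2]; abel
  refine ⟨p1, p2, ?_, ?_⟩
  · intro Y hT hA hBY
    have h5 := inv_comm hB1 hB2 hBY
    have c1 : Commute T Y := hT
    have c2 : Commute A Y := hA
    have c3 : Commute B' Y := h5
    rw [hP]
    exact ((c1.mul_left ((c2.mul_left c3).sub_left (Commute.one_left Y))).add_left
      ((Commute.one_left Y).smul_left q)).eq
  · set C := A * B' with hC
    set D := B * A' with hD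
    have hCD : C * D = 1 := by
      rw [hC, hD, mul_assoc, ← mul_assoc B', hB2, one_mul, hA1]
    have p2' : P * B' = A' * P := by
      calc P * B' = (A' * A) * P * B' := by rw [hA2, one_mul]
        _ = A' * (A * P) * B' := by noncomm_ring
        _ = A' * P * (B * B') := by rw [← p2]; noncomm_ring
        _ = _ := by rw [hB1, mul_one]
    have p1' : P * A' = B' * P := by
      calc P * A' = (B' * B) * P * A' := by rw [hB2, one_mul]
        _ = B' * (B * P) * A' := by noncomm_ring
        _ = B' * P * (A * A') := by rw [← p1]; noncomm_ring
        _ = _ := by rw [hA1, mul_one]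
    have pD : P * D = C * P := by
      rw [hD, hC, ← mul_assoc, p2, mul_assoc, p1', mul_assoc]
    have e1 : P * P = T * (P * (D - 1)) + q • P := by
      rw [mul_sub, pD]
      nth_rw 1 [hP]
      simp only [add_mul, sub_mul, mul_assoc, mul_one, one_mul, smul_mul_assoc]
    have huq : u * u - u * q = 1 := by rw [← hq]; field_simp; ring
    have e2 : T * (P * (D - 1)) = (T * T) * (2 - C - D) + q • (T * (D - 1)) := by
      have : 2 - C - D = (C - 1) * (D - 1) := by
        simp only [sub_mul, mul_sub, hCD, one_mul, mul_one]; 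
        rw [← one_add_one_eq_two]; abel
      rw [this, hP]
      simp only [add_mul, mul_add, mul_assoc, smul_mul_assoc, mul_smul_comm, one_mul]
    have e3 : P * P = (2 - C - D) + (q * q) • 1 := by
      rw [e1, e2, hTT, hP, ← one_add_one_eq_two]
      simp only [add_mul, mul_sub, smul_mul_assoc, one_mul, mul_one, smul_sub, smul_add, smul_smul, mul_add]
      abel
    rw [e3]
    have e4 : (u • (C - 1) + q • (1:E)) * (u • (D - 1) + q • (1:E)) =
        (u * u - u * q) • (2 - C - D) + (q * q) • 1 := by
      simp only [add_mul, mul_add, sub_mul, mul_sub, smul_mul_assoc, mul_smul_comm, one_mul,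
        mul_one, hCD, smul_smul, smul_sub, smul_add, sub_smul, ← one_add_one_eq_two, mul_comm q u]
      abel
    rw [e4, huq, one_smul]
/-- braid relation in a domain -/
theorem braid_dom {R : Type*} [CommRing R] [IsDomain R] (s r : R →+* R) (x y z p v : R)
    (sx : s x = y) (sy : s y = x) (sz : s z = z) (rx : r x = x) (ry : r y = z) (rz : r z = y)
    (sp : s p = p) (sv : s v = v) (rp : r p = p) (rv : r v = v)
    (ss : ∀ f, s (s f) = f) (rr : ∀ f, r (r f) = f) (srs : ∀ f, s (r (s f)) = r (s (r f)))
    (xy : y - x ≠ 0) (yz : z - y ≠ 0) (xz : z - x ≠ 0)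
    (S U : R → R)
    (hS : ∀ f, (y - x) * S f = (p * y - v * x) * s f - (p - v) * x * f)
    (hU : ∀ f, (z - y) * U f = (p * z - v * y) * r f - (p - v) * y * f) (f : R) :
    S (U (S f)) = U (S (U f)) := by
  have rS : ∀ f, (z - x) * r (S f) = (p * z - v * x) * r (s f) - (p - v) * x * r f := by
    intro f; have := congrArg r (hS f); simpa [rx, ry, rp, rv] using this
  have sU : ∀ f, (z - x) * s (U f) = (p * z - v * x) * s (r f) - (p - v) * x * s f := by
    intro f; have := congrArg s (hU f); simpa [sy, sz, sp, sv] using this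
  have sS : ∀ f, (x - y) * s (S f) = (p * x - v * y) * f - (p - v) * y * s f := by
    intro f; have := congrArg s (hS f); simpa [sx, sy, sp, sv, ss] using this
  have rU : ∀ f, (y - z) * r (U f) = (p * y - v * z) * f - (p - v) * z * r f := by
    intro f; have := congrArg r (hU f); simpa [ry, rz, rp, rv, rr] using this
  have srS : ∀ f, (z - y) * s (r (S f)) = (p * z - v * y) * s (r (s f)) - (p - v) * y * s (r f) := by
    intro f; have := congrArg s (rS f); simpa [sx, sz, sp, sv] using this
  have rsU : ∀ f, (y - x) * r (s (U f)) = (p * y - v * x) * s (r (s f)) - (p - v) * x * r (s f) := by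
    intro f; have := congrArg r (sU f); simpa [rz, rx, rp, rv, ← srs] using this
  let ι := algebraMap R (FractionRing R)
  have inj : Function.Injective ι := IsFractionRing.injective R (FractionRing R)
  have n1 : ι y - ι x ≠ 0 := by rw [← map_sub]; exact fun h => xy (inj (by simpa using h))
  have n2 : ι z - ι y ≠ 0 := by rw [← map_sub]; exact fun h => yz (inj (by simpa using h))
  have n3 : ι z - ι x ≠ 0 := by rw [← map_sub]; exact fun h => xz (inj (by simpa using h))
  have n1' : ι x - ι y ≠ 0 := by intro h; apply n1; linear_combination -h
  have n2' : ι y - ι z ≠ 0 := by intro h; apply n2; linear_combination -h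
  have conv : ∀ {d a b c : R}, d * a = b → ι d ≠ 0 → ι a = ι b / ι d := by
    intro d a b c h hd
    rw [eq_div_iff hd, ← h, map_mul, mul_comm]
  have D : ∀ {d a b : R}, d * a = b → ι d * ι a = ι b := by
    intro d a b h; rw [← map_mul, h]
  apply inj
  have kS := fun f => D (hS f)
  have kU := fun f => D (hU f)
  have krS := fun f => D (rS f)
  have ksU := fun f => D (sU f)
  have ksS := fun f => D (sS f)
  have krU := fun f => D (rU f)
  have ksrS := fun f => D (srS f)
  have krsU := fun f => D (rsU f)
  simp only [map_sub, map_mul] at kS kU krS ksU ksS krU ksrS krsU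
  have mk : ∀ {d a b : FractionRing R}, d ≠ 0 → d * a = b → a = b / d := by
    intro d a b hd h; rw [eq_div_iff hd, ← h, mul_comm]
  rw [mk n1 (kS _), mk n2 (kU (S (U f))), mk n3 (ksU _), mk n3 (krS _), mk n2 (kU _), mk n1 (kS (U f)),
    mk n2 (ksrS _), mk n1 (krsU _), mk n1' (ksS _), mk n2' (krU _), mk n3 (krS _), mk n3 (ksU _),
    mk n1 (kS _), mk n2 (kU _)]
  generalize ι x = x at *
  generalize ι y = y at *
  generalize ι z = z at *
  have m1 : x - y = -(y - x) := by ring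
  have m2 : y - z = -(z - y) := by ring
  rw [m1, m2]
  field_simp
  ring
section laur
variable {K : Type} [Field K] {n : ℕ}

theorem X_mul_Xinv (j : Fin n) : X K n j * Xinv K n j = 1 := by
  simp only [X, Xinv, AddMonoidAlgebra.single_mul_single, ← Pi.single_add]
  simp [AddMonoidAlgebra.one_def]

theorem laur_ext {R : Type*} [CommSemiring R] [Algebra K R] (f g : Laur K n →ₐ[K] R)
    (h : ∀ j, f (X K n j) = g (X K n j)) : f = g := by
  refine AddMonoidAlgebra.algHom_ext ?_ (Subsingleton.elim _ _)
  intro v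
  let F : (Laur K n →ₐ[K] R) → ((Fin n → ℤ) →+ Additive R) := fun f =>
    { toFun := fun v => Additive.ofMul (f (AddMonoidAlgebra.single v 1))
      map_zero' := by
        rw [← AddMonoidAlgebra.one_def, map_one]; rfl
      map_add' := fun a b => by
        rw [← ofMul_mul, ← map_mul, AddMonoidAlgebra.single_mul_single, one_mul] }
  have : F f = F g := by
    apply AddMonoidHom.functions_ext'
    intro j
    apply AddMonoidHom.ext_int
    exact h j
  exact DFunLike.congr_fun this v

theorem X_inj {i j : Fin n} (h : X K n i = X K n j) : i = j := by
  by_contra hne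
  have h2 := (AddMonoidAlgebra.single_left_inj (one_ne_zero (α := K))).1 h
  have h3 := congrFun h2 i
  simp [hne] at h3

theorem X_sub_ne {i j : Fin n} (h : i ≠ j) : X K n i - X K n j ≠ 0 :=
  fun e => h (X_inj (sub_eq_zero.mp e))

instance : IsDomain (Laur K n) := inferInstance
theorem T_clear {u : K} {i j : Fin n} {a sf f : Laur K n}
    (h : (X K n j * Xinv K n i - 1) * a = u • ((X K n j * Xinv K n i - 1) * sf)
      + (u - u⁻¹) • (sf - f)) :
    (X K n j - X K n i) * a = (algebraMap K _ u * X K n j - algebraMap K _ u⁻¹ * X K n i) * sf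
      - (algebraMap K _ u - algebraMap K _ u⁻¹) * X K n i * f := by
  have hx := X_mul_Xinv (K := K) i
  simp only [Algebra.smul_def, map_sub] at h
  linear_combination X K n i * h + X K n j * (algebraMap K _ u * sf - a) * hx

/-- a package for one Demazure–Lusztig operator -/
structure DL (u : K) (i j : Fin n) (s : Laur K n →ₐ[K] Laur K n)
    (T : Module.End K (Laur K n)) : Prop where
  ne : j ≠ i
  si : s (X K n i) = X K n j
  sj : s (X K n j) = X K n i
  sk : ∀ k, k ≠ i → k ≠ j → s (X K n k) = X K n k
  hT : ∀ f, (X K n j - X K n i) * T f =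
    (algebraMap K _ u * X K n j - algebraMap K _ u⁻¹ * X K n i) * s f
      - (algebraMap K _ u - algebraMap K _ u⁻¹) * X K n i * f

theorem DL.ss {u : K} {i j : Fin n} {s T} (h : DL u i j s T) (f : Laur K n) : s (s f) = f := by
  have : s.comp s = AlgHom.id K _ := by
    apply laur_ext
    intro k
    by_cases h1 : k = i
    · subst h1; simp [h.si, h.sj]
    by_cases h2 : k = j
    · subst h2; simp [h.si, h.sj]
    simp [h.sk k h1 h2]
  exact DFunLike.congr_fun this f

theorem DL.quad {u : K} (hu : u ≠ 0) {i j : Fin n} {s T} (h : DL u i j s T) :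
    T * (T - (u - u⁻¹) • 1) = 1 := by
  refine LinearMap.ext fun f => ?_
  rw [mul_sub]
  simp only [Module.End.mul_apply, LinearMap.sub_apply, mul_smul_comm, mul_one,
    LinearMap.smul_apply, Module.End.one_apply]
  have h1 := h.hT f
  have h2 := h.hT (T f)
  have h3 := congrArg s h1
  simp only [map_mul, map_sub, h.ss, AlgHom.commutes, h.si, h.sj] at h3
  have hn := X_sub_ne (K := K) h.ne
  apply mul_left_cancel₀ hn
  apply mul_left_cancel₀ hn
  have huu : algebraMap K (Laur K n) u * algebraMap K _ u⁻¹ = 1 := by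
    rw [← map_mul, mul_inv_cancel₀ hu, map_one]
  simp only [Algebra.smul_def, map_sub]
  generalize algebraMap K (Laur K n) u = p at *
  generalize algebraMap K (Laur K n) u⁻¹ = v at *
  generalize X K n i = x at *
  generalize X K n j = y at *
  linear_combination (y - x) * h2 - (p * y - v * x) * h3
    - ((p - v) * x + (p - v) * (y - x)) * h1 + (y-x)^2 * f * huu

theorem DL.intertw {u : K} {i j i' j' : Fin n} {s T s' T'} (h : DL u i j s T)
    (h' : DL u i' j' s' T') (g : Laur K n →ₐ[K] Laur K n) (c : K) (hc : c ≠ 0)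
    (gi : g (X K n i) = c • X K n i') (gj : g (X K n j) = c • X K n j')
    (hg : g.comp s = s'.comp g) (f : Laur K n) : g (T f) = T' (g f) := by
  have hg' : g (s f) = s' (g f) := DFunLike.congr_fun hg f
  have h1 := congrArg g (h.hT f)
  have h2 := h'.hT (g f)
  simp only [map_mul, map_sub, AlgHom.commutes, gi, gj, hg'] at h1
  have hn := X_sub_ne (K := K) h'.ne
  have hc' : algebraMap K (Laur K n) c ≠ 0 := by simpa using hc
  apply mul_left_cancel₀ hc'
  apply mul_left_cancel₀ hn
  simp only [Algebra.smul_def] at h1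
  linear_combination h1 - algebraMap K (Laur K n) c * h2

theorem DL.lin {u : K} {i j : Fin n} {s T} (h : DL u i j s T) (a f : Laur K n) (ha : s a = a) :
    T (a * f) = a * T f := by
  have h1 := h.hT f
  have h2 := h.hT (a * f)
  rw [map_mul s, ha] at h2
  apply mul_left_cancel₀ (X_sub_ne (K := K) h.ne)
  linear_combination h2 - a * h1

theorem DL.comm {u : K} {i j k l : Fin n} {s T s' T'} (h : DL u i j s T)
    (h' : DL u k l s' T') (h1 : i ≠ k) (h2 : i ≠ l) (h3 : j ≠ k) (h4 : j ≠ l) :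
    Commute T T' := by
  have hss : s.comp s' = s'.comp s := by
    apply laur_ext
    intro m
    simp only [AlgHom.comp_apply]
    by_cases e1 : m = i
    · subst e1; rw [h'.sk _ h1 h2, h.si, h'.sk _ h3 h4]
    by_cases e2 : m = j
    · subst e2; rw [h'.sk _ h3 h4, h.sj, h'.sk _ h1 h2]
    by_cases e3 : m = k
    · subst e3; rw [h'.si, h.sk _ h2.symm h4.symm, h.sk _ h1.symm h3.symm, h'.si]
    by_cases e4 : m = l
    · subst e4; rw [h'.sj, h.sk _ h1.symm h3.symm, h.sk _ h2.symm h4.symm, h'.sj]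
    rw [h'.sk _ e3 e4, h.sk _ e1 e2, h'.sk _ e3 e4]
  have I := h'.intertw h' s 1 one_ne_zero (by rw [h.sk _ h1.symm h3.symm, one_smul])
    (by rw [h.sk _ h2.symm h4.symm, one_smul]) hss
  change _ = _
  refine LinearMap.ext fun f => ?_
  simp only [Module.End.mul_apply]
  have e1 := h.hT (T' f)
  have e2 := congrArg T' (h.hT f)
  have fi := h'.sk _ h1 h2
  have fj := h'.sk _ h3 h4
  rw [map_sub, h'.lin _ _ (by simp only [map_sub, map_mul, AlgHom.commutes, fi, fj]), h'.lin _ _ (by simp only [map_sub, map_mul, AlgHom.commutes, fi, fj]),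
    h'.lin _ _ (by simp only [map_sub, map_mul, AlgHom.commutes, fi])] at e2
  apply mul_left_cancel₀ (X_sub_ne (K := K) h.ne)
  rw [e1, e2, I]

theorem DL.braid {u : K} {i j k : Fin n} {s T s' T'} (h : DL u i j s T)
    (h' : DL u j k s' T') (hik : k ≠ i) : T * T' * T = T' * T * T' := by
  have hss : (s.comp s').comp s = (s'.comp s).comp s' := by
    apply laur_ext
    intro m
    simp only [AlgHom.comp_apply]
    by_cases e1 : m = i
    · subst e1; rw [h.si, h'.si, h.sk _ hik h'.ne, h'.sk _ h.ne.symm hik.symm, h.si, h'.si]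
    by_cases e2 : m = j
    · subst e2; rw [h.sj, h'.sk _ h.ne.symm hik.symm, h.si, h'.si, h.sk _ hik h'.ne, h'.sj]
    by_cases e3 : m = k
    · subst e3; rw [h.sk _ hik h'.ne, h'.sj, h.sj, h'.sk _ h.ne.symm hik.symm]
    rw [h.sk _ e1 e2, h'.sk _ e2 e3, h.sk _ e1 e2, h'.sk _ e2 e3]
  refine LinearMap.ext fun f => ?_
  simp only [Module.End.mul_apply]
  exact braid_dom s.toRingHom s'.toRingHom (X K n i) (X K n j) (X K n k) (algebraMap K _ u)
    (algebraMap K _ u⁻¹) h.si h.sj (h.sk _ hik h'.ne) (h'.sk _ h.ne.symm hik.symm) h'.si h'.sj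
    (s.commutes _) (s.commutes _) (s'.commutes _) (s'.commutes _) h.ss h'.ss
    (fun f => DFunLike.congr_fun hss f) (X_sub_ne h.ne) (X_sub_ne h'.ne) (X_sub_ne hik)
    T T' h.hT h'.hT f

end laur

set_option maxHeartbeats 2000000 in
/-- Properties of the intertwining operators
`φᵢ = Tᵢ (Yᵢ Y_{i+1}⁻¹ - 1) + (u - u⁻¹)` (all indices 0-indexed):
(1) `φᵢ Yᵢ = Y_{i+1} φᵢ`, `φᵢ Y_{i+1} = Yᵢ φᵢ`, `φᵢ Yⱼ = Yⱼ φᵢ` for `j ≠ i, i+1`;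
(2) `φᵢ² = (u(YᵢY_{i+1}⁻¹-1) + (u-u⁻¹)) (u(Y_{i+1}Yᵢ⁻¹-1) + (u-u⁻¹))`. -/
theorem statement2 [CharZero K] (hn : 2 ≤ n) (u τ : K) (hu : u ≠ 0) (hτ : τ ≠ 0)
    (s : ∀ i : ℕ, i + 1 < n → (Laur K n ≃ₐ[K] Laur K n))
    (hs₁ : ∀ (i : ℕ) (hi : i + 1 < n),
      s i hi (X K n ⟨i, Nat.lt_of_succ_lt hi⟩) = X K n ⟨i + 1, hi⟩)
    (hs₂ : ∀ (i : ℕ) (hi : i + 1 < n),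
      s i hi (X K n ⟨i + 1, hi⟩) = X K n ⟨i, Nat.lt_of_succ_lt hi⟩)
    (hs₃ : ∀ (i : ℕ) (hi : i + 1 < n) (j : Fin n),
      (j : ℕ) ≠ i → (j : ℕ) ≠ i + 1 → s i hi (X K n j) = X K n j)
    (T : ∀ i : ℕ, i + 1 < n → Module.End K (Laur K n))
    (hT : ∀ (i : ℕ) (hi : i + 1 < n) (f : Laur K n),
      (X K n ⟨i + 1, hi⟩ * Xinv K n ⟨i, Nat.lt_of_succ_lt hi⟩ - 1) * (T i hi f)
        = u • ((X K n ⟨i + 1, hi⟩ * Xinv K n ⟨i, Nat.lt_of_succ_lt hi⟩ - 1) * (s i hi f))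
          + (u - u⁻¹) • (s i hi f - f))
    (w : Laur K n →ₐ[K] Laur K n)
    (hw₁ : w (X K n ⟨0, by omega⟩) = τ⁻¹ • X K n ⟨n - 1, by omega⟩)
    (hw₂ : ∀ j : Fin n, 0 < (j : ℕ) →
      w (X K n j) = X K n ⟨(j : ℕ) - 1, by omega⟩)
    -- each `Yⱼ` is invertible
    (hY : ∀ j : ℕ, j < n → IsUnit (Yop K n u T w.toLinearMap j)) :
    ∀ (i : ℕ) (hi : i + 1 < n) (Φ : Module.End K (Laur K n)),
      Φ = T i hi * (Yop K n u T w.toLinearMap i *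
            Ring.inverse (Yop K n u T w.toLinearMap (i + 1)) - 1) + (u - u⁻¹) • 1 →
      -- (1) `φᵢ` intertwines the `Y`-action through `sᵢ`
      (Φ * Yop K n u T w.toLinearMap i = Yop K n u T w.toLinearMap (i + 1) * Φ)
      ∧ (Φ * Yop K n u T w.toLinearMap (i + 1) = Yop K n u T w.toLinearMap i * Φ)
      ∧ (∀ j : Fin n, (j : ℕ) ≠ i → (j : ℕ) ≠ i + 1 →
          Φ * Yop K n u T w.toLinearMap (j : ℕ) = Yop K n u T w.toLinearMap (j : ℕ) * Φ)
      -- (2) the square of `φᵢ`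
      ∧ (Φ * Φ
          = (u • (Yop K n u T w.toLinearMap i *
                Ring.inverse (Yop K n u T w.toLinearMap (i + 1)) - 1) + (u - u⁻¹) • 1) *
            (u • (Yop K n u T w.toLinearMap (i + 1) *
                Ring.inverse (Yop K n u T w.toLinearMap i) - 1) + (u - u⁻¹) • 1)) := by
  have D : ∀ (i : ℕ) (hi : i + 1 < n), DL u ⟨i, Nat.lt_of_succ_lt hi⟩ ⟨i + 1, hi⟩
      (s i hi : Laur K n →ₐ[K] Laur K n) (T i hi) := fun i hi =>
    { ne := by simp
      si := hs₁ i hi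
      sj := hs₂ i hi
      sk := fun k h1 h2 => hs₃ i hi k (fun e => h1 (Fin.ext e)) (fun e => h2 (Fin.ext e))
      hT := fun f => T_clear (hT i hi f) }
  have hcs : ∀ (A : Module.End K (Laur K n)) (q : K), A * (A - q • 1) = (A - q • 1) * A := by
    intro A q; simp [mul_sub, sub_mul]
  let t : ℕ → (Module.End K (Laur K n))ˣ := fun i =>
    if h : i + 1 < n then
      ⟨T i h, T i h - (u - u⁻¹) • 1, (D i h).quad hu, by rw [← hcs]; exact (D i h).quad hu⟩
    else 1
  have ht : ∀ i (h : i + 1 < n), (t i : Module.End K (Laur K n)) = T i h := by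
    intro i h; simp [t, h]
  have htt : ∀ i, (t i : Module.End K (Laur K n)) = Tt K n T i := by
    intro i; by_cases h : i + 1 < n <;> simp [t, h, Tt]
  have hti : ∀ i, (((t i)⁻¹ : (Module.End K (Laur K n))ˣ) : Module.End K (Laur K n))
      = Tinvt K n u T i := by
    intro i; by_cases h : i + 1 < n <;> simp [t, h, Tinvt]
  have pr1 : ∀ m j, ((List.range m).map fun k => Tinvt K n u T (j + k)).prod =
      ((((List.range m).map fun k => (t (j + k))⁻¹).prod : (Module.End K (Laur K n))ˣ) :
        Module.End K (Laur K n)) := by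
    intro m j
    induction m with
    | zero => simp
    | succ m ih =>
      simp only [List.range_succ, List.map_append, List.prod_append, ih, Units.val_mul]
      simp [hti]
  have pr2 : ∀ m, ((List.range m).map fun k => Tt K n T k).prod =
      ((((List.range m).map fun k => t k).prod : (Module.End K (Laur K n))ˣ) :
        Module.End K (Laur K n)) := by
    intro m
    induction m with
    | zero => simp
    | succ m ih =>
      simp only [List.range_succ, List.map_append, List.prod_append, ih, Units.val_mul]
      simp [htt]
  have hwu : IsUnit (w.toLinearMap : Module.End K (Laur K n)) := by
    have h0 := hY 0 (by omega)
    unfold Yop at h0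
    rw [pr1, pr2] at h0
    rwa [Units.isUnit_mul_units, Units.isUnit_units_mul] at h0
  obtain ⟨W, hW⟩ := hwu
  have hYop : ∀ j, Yop K n u T w.toLinearMap j =
      ((Yg t W n j : (Module.End K (Laur K n))ˣ) : Module.End K (Laur K n)) := by
    intro j
    unfold Yop Yg
    rw [pr1, pr2, ← hW, Units.val_mul, Units.val_mul]
  obtain ⟨m, rfl⟩ : ∃ m, n = m + 2 := ⟨n - 2, by omega⟩
  have hwX : ∀ k (h : k + 1 < m + 2), w (X K (m+2) ⟨k+1, h⟩) = X K (m+2) ⟨k, by omega⟩ := by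
    intro k h
    exact hw₂ ⟨k+1, h⟩ (by simp)
  have hwX0 : w (X K (m+2) ⟨0, by omega⟩) = τ⁻¹ • X K (m+2) ⟨m+1, by omega⟩ := hw₁
  obtain ⟨M1, M2⟩ := Yg_main t W m
    (by
      intro i hi
      ext1
      simp only [Units.val_mul]
      rw [ht i (by omega), ht (i+1) (by omega)]
      exact (D i (by omega)).braid (D (i+1) (by omega)) (by simp; omega))
    (by
      intro i j h1 h2
      change _ = _
      ext1
      simp only [Units.val_mul]
      rw [ht i (by omega), ht j (by omega)]
      exact ((D i (by omega)).comm (D j (by omega)) (by simp; omega) (by simp; omega)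
        (by simp; omega) (by simp; omega)).eq)
    (by
      intro k hk
      ext1
      simp only [Units.val_mul]
      rw [ht k (by omega), ht (k+1) (by omega), hW]
      refine LinearMap.ext fun f => ?_
      refine (D (k+1) (by omega)).intertw (D k (by omega)) w 1 one_ne_zero
        (by rw [hwX, one_smul]) (by rw [hwX, one_smul]) ?_ f
      apply laur_ext
      rintro ⟨l, hl⟩
      have d1 := D (k+1) (by omega)
      have d2 := D k (by omega)
      simp only [AlgHom.comp_apply]
      by_cases e1 : l = k + 1
      · subst e1; rw [d1.si, hwX, hwX, d2.si]
      by_cases e2 : l = k + 2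
      · subst e2; rw [d1.sj, hwX, hwX, d2.sj]
      rw [d1.sk _ (by simpa using e1) (by simpa using e2)]
      rcases l with _ | l
      · rw [hwX0, map_smul, d2.sk _ (by simp; omega) (by simp; omega)]
      · rw [hwX, d2.sk _ (by simp; omega) (by simp; omega)])
    (by
      ext1
      simp only [Units.val_mul]
      rw [ht 0 (by omega), ht m (by omega), hW]
      refine LinearMap.ext fun f => ?_
      have d1 := D 0 (by omega)
      have d2 := D m (by omega)
      have g0 : (w.comp w) (X K (m+2) ⟨0, by omega⟩) = τ⁻¹ • X K (m+2) ⟨m, by omega⟩ := by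
        rw [AlgHom.comp_apply, hwX0, map_smul, hwX]
      have g1 : (w.comp w) (X K (m+2) ⟨0+1, by omega⟩) = τ⁻¹ • X K (m+2) ⟨m+1, by omega⟩ := by
        rw [AlgHom.comp_apply, hwX, hwX0]
      have g2 : ∀ l (hl : l + 2 < m + 2),
          (w.comp w) (X K (m+2) ⟨l+2, hl⟩) = X K (m+2) ⟨l, by omega⟩ := by
        intro l hl
        rw [AlgHom.comp_apply, hwX (l+1), hwX]
      refine d1.intertw d2 (w.comp w) τ⁻¹ (inv_ne_zero hτ) g0 g1 ?_ f
      generalize w.comp w = g at *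
      apply laur_ext
      rintro ⟨l, hl⟩
      rw [AlgHom.comp_apply, AlgHom.comp_apply]
      by_cases e1 : l = 0
      · subst e1; rw [d1.si, g1, g0, map_smul, d2.si]
      by_cases e2 : l = 0 + 1
      · subst e2; rw [d1.sj, g1, g0, map_smul, d2.sj]
      obtain ⟨l, rfl⟩ : ∃ k, l = k + 2 := ⟨l - 2, by omega⟩
      rw [d1.sk _ (by simp) (by simp), g2, d2.sk _ (by simp; omega) (by simp; omega)])
  intro i hi Φ hΦ
  simp only [hYop, Ring.inverse_unit] at hΦ ⊢
  obtain ⟨r1, r2, r3, r4⟩ := phi_alg u hu (T i hi) (T i hi - (u - u⁻¹) • 1)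
    ((Yg t W (m+2) i : (Module.End K (Laur K (m+2)))ˣ) : Module.End K (Laur K (m+2)))
    ((Yg t W (m+2) (i+1) : (Module.End K (Laur K (m+2)))ˣ) : Module.End K (Laur K (m+2)))
    ((Yg t W (m+2) i)⁻¹ : (Module.End K (Laur K (m+2)))ˣ)
    ((Yg t W (m+2) (i+1))⁻¹ : (Module.End K (Laur K (m+2)))ˣ) Φ rfl ((D i hi).quad hu)
    (by rw [← hcs]; exact (D i hi).quad hu)
    (by rw [Yg_succ _ _ _ _ hi, Units.val_mul, Units.val_mul, ht i hi])
    (by rw [← Units.val_mul, (M2 i hi).eq, Units.val_mul])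
    (Units.mul_inv _) (Units.inv_mul _) (Units.mul_inv _) (Units.inv_mul _) hΦ
  refine ⟨r1, r2, fun j h1 h2 => ?_, r4⟩
  have c0 := M1 i j hi j.2 h1 h2
  have c1 := Yg_comm t W (m+2) M1 M2 i j (by omega) j.2
  have c2 := Yg_comm t W (m+2) M1 M2 (i+1) j hi j.2
  refine r3 _ ?_ ?_ ?_
  · rw [← ht i hi, ← Units.val_mul, c0.eq, Units.val_mul]
  · rw [← Units.val_mul, c1.eq, Units.val_mul]
  · rw [← Units.val_mul, c2.eq, Units.val_mul]
end DAHA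
end
end

section
/- (Hayashi realization of the Fock space: Cartan-type relations.) The operators on the Fock space F satisfy: K_i K_j = K_j K_i and K_i K_i^{−1} = K_i^{−1} K_i = 1 for all i, j ∈ Z/ℓ; K_i E_j = q^{a_{ij}} E_j K_i and K_i F_j = q^{−a_{ij}} F_j K_i for all i, j ∈ Z/ℓ; and E_i F_j − F_j E_i = δ_{ij}·(K_i − K_i^{−1})/(q − q^{−1}) for all i, j ∈ Z/ℓ. -/
noncomputable section

open scoped BigOperators Classical

namespace FockSpace

/-- The base field `ℚ(q)`. -/
abbrev Fq : Type := RatFunc ℚ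

/-- The indeterminate `q ∈ ℚ(q)`. -/
def qq : Fq := RatFunc.X

/-- The Fock space: the free `ℚ(q)`-module on the set of all partitions (identified with
their Young diagrams). -/
abbrev Fock : Type := YoungDiagram →₀ Fq

variable (ℓ : ℕ)

/-- The `ℓ`-residue of a cell `(r, c)` (0-indexed rows and columns): `(c - r) mod ℓ`. -/
def res (x : ℕ × ℕ) : ZMod ℓ := (((x.2 : ℤ) - (x.1 : ℤ) : ℤ) : ZMod ℓ)

/-- `x` is an addable cell of `μ`: `x ∉ μ` and `μ ∪ {x}` is again a Young diagram. -/
def IsAddableCell (μ : YoungDiagram) (x : ℕ × ℕ) : Prop :=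
  x ∉ μ ∧ IsLowerSet (insert x (μ.cells : Set (ℕ × ℕ)))

/-- `x` is a removable cell of `μ`: `x ∈ μ` and `μ \ {x}` is again a Young diagram. -/
def IsRemovableCell (μ : YoungDiagram) (x : ℕ × ℕ) : Prop :=
  x ∈ μ ∧ IsLowerSet ((μ.cells.erase x : Finset (ℕ × ℕ)) : Set (ℕ × ℕ))

/-- The finite set of `i`-addable cells of `μ`. -/
def addables (i : ZMod ℓ) (μ : YoungDiagram) : Finset (ℕ × ℕ) :=
  (Finset.range (μ.cells.card + 1) ×ˢ Finset.range (μ.cells.card + 1)).filter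
    fun x => IsAddableCell μ x ∧ res ℓ x = i

/-- The finite set of `i`-removable cells of `μ`. -/
def removables (i : ZMod ℓ) (μ : YoungDiagram) : Finset (ℕ × ℕ) :=
  μ.cells.filter fun x => IsRemovableCell μ x ∧ res ℓ x = i

/-- Adding a cell to a Young diagram (returns `μ` unchanged if the result would not be a
Young diagram). -/
def addCell (μ : YoungDiagram) (x : ℕ × ℕ) : YoungDiagram :=
  if h : IsLowerSet (insert x (μ.cells : Set (ℕ × ℕ))) then
    ⟨insert x μ.cells, by simpa using h⟩
  else μ

/-- Removing a cell from a Young diagram (returns `μ` unchanged if the result would not be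
a Young diagram). -/
def eraseCell (μ : YoungDiagram) (x : ℕ × ℕ) : YoungDiagram :=
  if h : IsLowerSet ((μ.cells.erase x : Finset (ℕ × ℕ)) : Set (ℕ × ℕ)) then
    ⟨μ.cells.erase x, h⟩
  else μ

/-- `N_i^a(λ, μ)` where `μ = λ ∪ {x}`: the number of `i`-addable minus `i`-removable cells
of `λ` in rows strictly above `x`. -/
def Na (i : ZMod ℓ) (lam : YoungDiagram) (x : ℕ × ℕ) : ℤ :=
  (((addables ℓ i lam).filter fun y => y.1 < x.1).card : ℤ)
    - (((removables ℓ i lam).filter fun y => y.1 < x.1).card : ℤ)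

/-- `N_i^b(λ, μ)` where `μ = λ ∪ {x}`: the number of `i`-addable minus `i`-removable cells
of `λ` in rows strictly below `x`. -/
def Nb (i : ZMod ℓ) (lam : YoungDiagram) (x : ℕ × ℕ) : ℤ :=
  (((addables ℓ i lam).filter fun y => x.1 < y.1).card : ℤ)
    - (((removables ℓ i lam).filter fun y => x.1 < y.1).card : ℤ)

/-- `N_i(λ)`: the number of `i`-addable minus `i`-removable cells of `λ`. -/
def Nstat (i : ZMod ℓ) (lam : YoungDiagram) : ℤ :=
  ((addables ℓ i lam).card : ℤ) - ((removables ℓ i lam).card : ℤ)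

/-- The operator `E_i` of the Hayashi realization:
`E_i |μ⟩ = Σ q^{-N_i^a(λ,μ)} |λ⟩`, summed over `λ` with `μ = λ ∪ {x}`, `res x = i`. -/
def Eop (i : ZMod ℓ) : Module.End Fq Fock :=
  Finsupp.linearCombination Fq fun μ =>
    ∑ x ∈ removables ℓ i μ,
      (qq ^ (-(Na ℓ i (eraseCell μ x) x))) • Finsupp.single (eraseCell μ x) (1 : Fq)

/-- The operator `F_i` of the Hayashi realization:
`F_i |λ⟩ = Σ q^{N_i^b(λ,μ)} |μ⟩`, summed over `μ` with `μ = λ ∪ {x}`, `res x = i`. -/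
def Fop (i : ZMod ℓ) : Module.End Fq Fock :=
  Finsupp.linearCombination Fq fun lam =>
    ∑ x ∈ addables ℓ i lam,
      (qq ^ (Nb ℓ i lam x)) • Finsupp.single (addCell lam x) (1 : Fq)

/-- The operator `K_i` of the Hayashi realization: `K_i |λ⟩ = q^{N_i(λ)} |λ⟩`. -/
def Kop (i : ZMod ℓ) : Module.End Fq Fock :=
  Finsupp.linearCombination Fq fun lam =>
    (qq ^ (Nstat ℓ i lam)) • Finsupp.single lam (1 : Fq)

/-- The operator `K_i⁻¹` of the Hayashi realization: `K_i⁻¹ |λ⟩ = q^{-N_i(λ)} |λ⟩`. -/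
def Kinvop (i : ZMod ℓ) : Module.End Fq Fock :=
  Finsupp.linearCombination Fq fun lam =>
    (qq ^ (-(Nstat ℓ i lam))) • Finsupp.single lam (1 : Fq)

/-- The Cartan matrix of type `A_{ℓ-1}^{(1)}`. -/
def cartan (i j : ZMod ℓ) : ℤ :=
  if i = j then 2 else if ℓ = 2 then -2 else if i = j + 1 ∨ i = j - 1 then -1 else 0

def cc (x : ℕ × ℕ) : ℤ := (x.2 : ℤ) - x.1

lemma mem_cells_iff (μ : YoungDiagram) (r c : ℕ) : (r, c) ∈ μ.cells ↔ c < μ.rowLen r := by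
  rw [YoungDiagram.mem_cells, YoungDiagram.mem_iff_lt_rowLen]

lemma addable_iff (μ : YoungDiagram) (x : ℕ × ℕ) :
    IsAddableCell μ x ↔ x.2 = μ.rowLen x.1 ∧ ∀ r < x.1, x.2 < μ.rowLen r := by
  obtain ⟨r, c⟩ := x
  unfold IsAddableCell
  constructor
  · rintro ⟨h1, h2⟩
    rw [YoungDiagram.mem_iff_lt_rowLen] at h1
    refine ⟨?_, fun r' hr' => ?_⟩
    · by_contra hne
      have h3 : ((r, μ.rowLen r) : ℕ × ℕ) ≤ (r, c) := ⟨le_rfl, by simpa using h1⟩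
      have := h2 h3 (Set.mem_insert _ _)
      simp [YoungDiagram.mem_iff_lt_rowLen] at this
      simp at hne; omega
    · have h3 : ((r', c) : ℕ × ℕ) ≤ (r, c) := ⟨le_of_lt hr', le_rfl⟩
      have := h2 h3 (Set.mem_insert _ _)
      simp [YoungDiagram.mem_iff_lt_rowLen] at this
      simp at hr'
      rcases this with h | h
      · omega
      · exact h
  · rintro ⟨h1, h2⟩
    simp only at h1 h2
    refine ⟨by rw [YoungDiagram.mem_iff_lt_rowLen]; omega, ?_⟩
    rintro ⟨a, b⟩ ⟨a', b'⟩ hab hm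
    have ha : a' ≤ a := hab.1
    have hb : b' ≤ b := hab.2
    simp [YoungDiagram.mem_iff_lt_rowLen] at hm ⊢
    rcases hm with ⟨rfl, rfl⟩ | hm
    · rcases Nat.lt_or_ge a' a with h | h
      · have := h2 a' h
        right; omega
      · have : a' = a := le_antisymm ha h
        subst this
        omega
    · right
      have := μ.rowLen_anti a' a ha
      omega

lemma removable_iff (μ : YoungDiagram) (x : ℕ × ℕ) :
    IsRemovableCell μ x ↔ μ.rowLen x.1 = x.2 + 1 ∧ ∀ r, x.1 < r → μ.rowLen r ≤ x.2 := by
  obtain ⟨r, c⟩ := x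
  unfold IsRemovableCell
  constructor
  · rintro ⟨h1, h2⟩
    rw [YoungDiagram.mem_iff_lt_rowLen] at h1
    have key : ∀ r' c', r ≤ r' → c ≤ c' → (r', c') ≠ (r, c) → μ.rowLen r' ≤ c' := by
      intro r' c' hr hc hne
      by_contra hlt
      have := @h2 (r', c') (r, c) ⟨hr, hc⟩
        (by simp [YoungDiagram.mem_iff_lt_rowLen] at hne ⊢; exact ⟨by omega, hne⟩)
      simp at this
    refine ⟨?_, fun r' hr' => ?_⟩
    · have := key r (c + 1) le_rfl (by omega) (by simp)
      simp only; omega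
    · simp only at hr'
      exact key r' c (by omega) le_rfl (by simp; omega)
  · rintro ⟨h1, h2⟩
    simp only at h1 h2
    refine ⟨by rw [YoungDiagram.mem_iff_lt_rowLen]; omega, ?_⟩
    rintro ⟨a, b⟩ ⟨a', b'⟩ hab hm
    have ha : a' ≤ a := hab.1
    have hb : b' ≤ b := hab.2
    simp [YoungDiagram.mem_iff_lt_rowLen] at hm ⊢
    have h3 := μ.rowLen_anti a' a ha
    refine ⟨by omega, ?_⟩
    rintro rfl rfl
    rcases Nat.lt_or_ge a' a with h | h
    · have := h2 a h
      omega
    · have : a' = a := le_antisymm ha h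
      subst this
      have := hm.2 rfl
      omega

lemma addable_bound (μ : YoungDiagram) (x : ℕ × ℕ) (h : IsAddableCell μ x) :
    x.1 < μ.cells.card + 1 ∧ x.2 < μ.cells.card + 1 := by
  rw [addable_iff] at h
  obtain ⟨h1, h2⟩ := h
  constructor
  · have : ((Finset.range x.1).image fun r => (r, 0)) ⊆ μ.cells := by
      intro z hz
      simp only [Finset.mem_image, Finset.mem_range] at hz
      obtain ⟨r, hr, rfl⟩ := hz
      rw [mem_cells_iff]
      have := h2 r hr
      omega
    have := Finset.card_le_card this
    rw [Finset.card_image_of_injective _ (fun a b hab => by simpa using hab)] at this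
    simp at this; omega
  · have : ((Finset.range x.2).image fun r => (x.1, r)) ⊆ μ.cells := by
      intro z hz
      simp only [Finset.mem_image, Finset.mem_range] at hz
      obtain ⟨r, hr, rfl⟩ := hz
      rw [mem_cells_iff]
      omega
    have := Finset.card_le_card this
    rw [Finset.card_image_of_injective _ (fun a b hab => by simpa using hab)] at this
    simp at this; omega

lemma mem_addables (i : ZMod ℓ) (μ : YoungDiagram) (x : ℕ × ℕ) :
    x ∈ addables ℓ i μ ↔ IsAddableCell μ x ∧ ((cc x : ℤ) : ZMod ℓ) = i := by
  unfold addables res cc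
  simp only [Finset.mem_filter, Finset.mem_product, Finset.mem_range]
  constructor
  · exact fun h => h.2
  · exact fun h => ⟨addable_bound μ x h.1, h⟩

lemma mem_removables (i : ZMod ℓ) (μ : YoungDiagram) (x : ℕ × ℕ) :
    x ∈ removables ℓ i μ ↔ IsRemovableCell μ x ∧ ((cc x : ℤ) : ZMod ℓ) = i := by
  unfold removables res cc
  simp only [Finset.mem_filter]
  constructor
  · exact fun h => h.2
  · exact fun h => ⟨h.1.1, h⟩

/-- beta set -/
def SS (μ : YoungDiagram) (d : ℤ) : Prop := ∃ r : ℕ, d = (μ.rowLen r : ℤ) - r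

lemma beta_inj (μ : YoungDiagram) {r s : ℕ}
    (h : (μ.rowLen r : ℤ) - r = (μ.rowLen s : ℤ) - s) : r = s := by
  rcases lt_trichotomy r s with h1 | h1 | h1
  · have := μ.rowLen_anti r s h1.le
    omega
  · exact h1
  · have := μ.rowLen_anti s r h1.le
    omega

lemma addable_SS (μ : YoungDiagram) (d : ℤ) :
    (∃ x, IsAddableCell μ x ∧ cc x = d) ↔ SS μ d ∧ ¬ SS μ (d + 1) := by
  constructor
  · rintro ⟨⟨r, c⟩, h, rfl⟩
    rw [addable_iff] at h
    simp only at h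
    obtain ⟨h1, h2⟩ := h
    refine ⟨⟨r, by simp [cc, h1]⟩, ?_⟩
    rintro ⟨s, hs⟩
    simp only [cc] at hs
    rcases lt_trichotomy r s with h | h | h
    · have := μ.rowLen_anti r s h.le
      omega
    · subst h; omega
    · have := h2 s h
      omega
  · rintro ⟨⟨r, hr⟩, h⟩
    refine ⟨(r, μ.rowLen r), ?_, by simp [cc, hr]⟩
    rw [addable_iff]
    refine ⟨rfl, fun s hs => ?_⟩
    simp only at hs ⊢
    by_contra hlt
    apply h
    have h1 := μ.rowLen_anti s (r - 1) (by omega)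
    have h2 := μ.rowLen_anti (r - 1) r (by omega)
    exact ⟨r - 1, by omega⟩

lemma removable_SS (μ : YoungDiagram) (d : ℤ) :
    (∃ x, IsRemovableCell μ x ∧ cc x = d) ↔ SS μ (d + 1) ∧ ¬ SS μ d := by
  constructor
  · rintro ⟨⟨r, c⟩, h, rfl⟩
    rw [removable_iff] at h
    simp only at h
    obtain ⟨h1, h2⟩ := h
    refine ⟨⟨r, by simp [cc, h1]; ring⟩, ?_⟩
    rintro ⟨s, hs⟩
    simp only [cc] at hs
    rcases lt_trichotomy r s with h | h | h
    · have := h2 s h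
      omega
    · subst h; omega
    · have := μ.rowLen_anti s r h.le
      omega
  · rintro ⟨⟨r, hr⟩, h⟩
    have h0 : μ.rowLen (r + 1) < μ.rowLen r := by
      by_contra hlt
      have := μ.rowLen_anti r (r + 1) (by omega)
      exact h ⟨r + 1, by push_cast; omega⟩
    refine ⟨(r, μ.rowLen r - 1), ?_, by simp only [cc]; omega⟩
    rw [removable_iff]
    refine ⟨by simp only; omega, fun s hs => ?_⟩
    simp only at hs ⊢
    have := μ.rowLen_anti (r + 1) s (by omega)
    omega

lemma addable_inj (μ : YoungDiagram) {x y : ℕ × ℕ} (hx : IsAddableCell μ x)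
    (hy : IsAddableCell μ y) (h : cc x = cc y) : x = y := by
  rw [addable_iff] at hx hy
  simp only [cc, hx.1, hy.1] at h
  have h1 := beta_inj μ h
  exact Prod.ext h1 (by rw [hx.1, hy.1, h1])

lemma removable_inj (μ : YoungDiagram) {x y : ℕ × ℕ} (hx : IsRemovableCell μ x)
    (hy : IsRemovableCell μ y) (h : cc x = cc y) : x = y := by
  rw [removable_iff] at hx hy
  have h0 := hx.1
  have h0' := hy.1
  have h1 := beta_inj μ (r := x.1) (s := y.1) (by simp only [cc] at h; omega)
  refine Prod.ext h1 ?_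
  rw [h1] at h0
  omega

def gg (μ : YoungDiagram) (d : ℤ) : ℤ := (if SS μ d then 1 else 0) - (if SS μ (d + 1) then 1 else 0)

lemma card_le_of_removable (μ : YoungDiagram) (x : ℕ × ℕ) (h : x ∈ μ) :
    x.1 < μ.cells.card ∧ x.2 < μ.cells.card := by
  constructor
  · have : ((Finset.range (x.1 + 1)).image fun r => (r, x.2)) ⊆ μ.cells := by
      intro z hz
      simp only [Finset.mem_image, Finset.mem_range] at hz
      obtain ⟨r, hr, rfl⟩ := hz
      exact μ.isLowerSet (show (r, x.2) ≤ x from ⟨by simp only; omega, le_rfl⟩) h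
    have := Finset.card_le_card this
    rw [Finset.card_image_of_injective _ (fun a b hab => by simpa using hab)] at this
    simp at this; omega
  · have : ((Finset.range (x.2 + 1)).image fun r => (x.1, r)) ⊆ μ.cells := by
      intro z hz
      simp only [Finset.mem_image, Finset.mem_range] at hz
      obtain ⟨r, hr, rfl⟩ := hz
      exact μ.isLowerSet (show (x.1, r) ≤ x from ⟨le_rfl, by simp only; omega⟩) h
    have := Finset.card_le_card this
    rw [Finset.card_image_of_injective _ (fun a b hab => by simpa using hab)] at this
    simp at this; omega

lemma sum_eq {K : Type*} [CommRing K] (i : ZMod ℓ) (μ : YoungDiagram) (h : ℤ → K) (M : ℤ)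
    (hM : (μ.cells.card : ℤ) ≤ M) :
    ∑ x ∈ addables ℓ i μ, h (cc x) - ∑ x ∈ removables ℓ i μ, h (cc x)
      = ∑ d ∈ (Finset.Icc (-M) M).filter (fun d : ℤ => (d : ZMod ℓ) = i), (gg μ d : K) * h d := by
  have h1 : ∑ x ∈ addables ℓ i μ, h (cc x)
      = ∑ d ∈ ((Finset.Icc (-M) M).filter (fun d : ℤ => (d : ZMod ℓ) = i)).filter
          (fun d => SS μ d ∧ ¬ SS μ (d + 1)), h d := by
    refine Finset.sum_bij (fun x _ => cc x) ?_ ?_ ?_ ?_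
    · intro x hx
      rw [mem_addables] at hx
      have hb := addable_bound μ x hx.1
      simp only [Finset.mem_filter, Finset.mem_Icc]
      refine ⟨⟨⟨?_, ?_⟩, hx.2⟩, (addable_SS μ _).1 ⟨x, hx.1, rfl⟩⟩ <;> (simp only [cc]; omega)
    · intro x hx y hy hxy
      rw [mem_addables] at hx hy
      exact addable_inj μ hx.1 hy.1 hxy
    · intro d hd
      simp only [Finset.mem_filter] at hd
      obtain ⟨x, hx, hxd⟩ := (addable_SS μ d).2 hd.2
      exact ⟨x, by rw [mem_addables, hxd]; exact ⟨hx, hd.1.2⟩, hxd⟩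
    · intros; rfl
  have h2 : ∑ x ∈ removables ℓ i μ, h (cc x)
      = ∑ d ∈ ((Finset.Icc (-M) M).filter (fun d : ℤ => (d : ZMod ℓ) = i)).filter
          (fun d => SS μ (d + 1) ∧ ¬ SS μ d), h d := by
    refine Finset.sum_bij (fun x _ => cc x) ?_ ?_ ?_ ?_
    · intro x hx
      rw [mem_removables] at hx
      have hb := card_le_of_removable μ x hx.1.1
      simp only [Finset.mem_filter, Finset.mem_Icc]
      refine ⟨⟨⟨?_, ?_⟩, hx.2⟩, (removable_SS μ _).1 ⟨x, hx.1, rfl⟩⟩ <;> (simp only [cc]; omega)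
    · intro x hx y hy hxy
      rw [mem_removables] at hx hy
      exact removable_inj μ hx.1 hy.1 hxy
    · intro d hd
      simp only [Finset.mem_filter] at hd
      obtain ⟨x, hx, hxd⟩ := (removable_SS μ d).2 hd.2
      exact ⟨x, by rw [mem_removables, hxd]; exact ⟨hx, hd.1.2⟩, hxd⟩
    · intros; rfl
  rw [h1, h2, Finset.sum_filter (fun d => SS μ d ∧ ¬ SS μ (d + 1)),
    Finset.sum_filter (fun d => SS μ (d + 1) ∧ ¬ SS μ d), ← Finset.sum_sub_distrib]
  refine Finset.sum_congr rfl fun d _ => ?_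
  unfold gg
  by_cases ha : SS μ d <;> by_cases hb : SS μ (d + 1) <;> simp [ha, hb]

def DD (i : ZMod ℓ) (μ : YoungDiagram) (h : ℤ → ℤ) : ℤ :=
  ∑ x ∈ addables ℓ i μ, h (cc x) - ∑ x ∈ removables ℓ i μ, h (cc x)

lemma addCell_cells {μ : YoungDiagram} {x : ℕ × ℕ} (hx : IsAddableCell μ x) :
    (addCell μ x).cells = insert x μ.cells := by
  unfold addCell
  rw [dif_pos hx.2]

lemma eraseCell_cells {μ : YoungDiagram} {x : ℕ × ℕ} (hx : IsRemovableCell μ x) :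
    (eraseCell μ x).cells = μ.cells.erase x := by
  unfold eraseCell
  rw [dif_pos hx.2]

lemma removable_addCell {μ : YoungDiagram} {x : ℕ × ℕ} (hx : IsAddableCell μ x) :
    IsRemovableCell (addCell μ x) x := by
  have hx1 : x ∉ μ.cells := hx.1
  refine ⟨?_, ?_⟩
  · rw [← YoungDiagram.mem_cells, addCell_cells hx]; simp
  · rw [addCell_cells hx, Finset.erase_insert hx1]; exact μ.isLowerSet

lemma erase_add {μ : YoungDiagram} {x : ℕ × ℕ} (hx : IsAddableCell μ x) :
    eraseCell (addCell μ x) x = μ := by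
  have hx1 : x ∉ μ.cells := hx.1
  apply YoungDiagram.ext
  rw [eraseCell_cells (removable_addCell hx), addCell_cells hx, Finset.erase_insert hx1]

lemma addable_eraseCell {μ : YoungDiagram} {x : ℕ × ℕ} (hx : IsRemovableCell μ x) :
    IsAddableCell (eraseCell μ x) x := by
  have hx1 : x ∈ μ.cells := hx.1
  refine ⟨?_, ?_⟩
  · rw [← YoungDiagram.mem_cells, eraseCell_cells hx]; simp
  · rw [eraseCell_cells hx, ← Finset.coe_insert, Finset.insert_erase hx1]; exact μ.isLowerSet

lemma add_erase {μ : YoungDiagram} {x : ℕ × ℕ} (hx : IsRemovableCell μ x) :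
    addCell (eraseCell μ x) x = μ := by
  have hx1 : x ∈ μ.cells := hx.1
  apply YoungDiagram.ext
  rw [addCell_cells (addable_eraseCell hx), eraseCell_cells hx, Finset.insert_erase hx1]

lemma rowLen_addCell {μ : YoungDiagram} {x : ℕ × ℕ} (hx : IsAddableCell μ x) (r : ℕ) :
    (addCell μ x).rowLen r = if r = x.1 then x.2 + 1 else μ.rowLen r := by
  have key : ∀ c, c < (addCell μ x).rowLen r ↔ c < if r = x.1 then x.2 + 1 else μ.rowLen r := by
    intro c
    rw [← mem_cells_iff, addCell_cells hx, Finset.mem_insert, mem_cells_iff]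
    rw [addable_iff] at hx
    obtain ⟨a, b⟩ := x
    simp only [Prod.mk.injEq] at hx ⊢
    split_ifs with h
    · subst h; omega
    · omega
  have h1 := key ((addCell μ x).rowLen r)
  have h2 := key (if r = x.1 then x.2 + 1 else μ.rowLen r)
  omega

lemma SS_addCell {μ : YoungDiagram} {x : ℕ × ℕ} (hx : IsAddableCell μ x) (d : ℤ) :
    SS (addCell μ x) d ↔ (d = cc x + 1 ∨ (SS μ d ∧ d ≠ cc x)) := by
  have hx' := (addable_iff _ _).1 hx
  unfold SS
  constructor
  · rintro ⟨r, hr⟩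
    rw [rowLen_addCell hx] at hr
    split_ifs at hr with h
    · left; simp only [cc]; subst h; push_cast at hr; omega
    · right
      refine ⟨⟨r, hr⟩, fun hd => h ?_⟩
      apply beta_inj μ
      rw [← hr, hd, cc, hx'.1]
  · rintro (h | ⟨⟨r, hr⟩, h⟩)
    · refine ⟨x.1, ?_⟩
      rw [rowLen_addCell hx, if_pos rfl, h, cc]; push_cast; ring
    · refine ⟨r, ?_⟩
      rw [rowLen_addCell hx, if_neg, hr]
      rintro rfl
      apply h; rw [hr, cc, hx'.1]

lemma gg_addCell {μ : YoungDiagram} {x : ℕ × ℕ} (hx : IsAddableCell μ x) (d : ℤ) :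
    gg (addCell μ x) d = gg μ d + (if d = cc x + 1 then 1 else 0) + (if d = cc x - 1 then 1 else 0)
      - 2 * (if d = cc x then 1 else 0) := by
  have h := (addable_SS μ (cc x)).1 ⟨x, hx, rfl⟩
  unfold gg
  simp only [SS_addCell hx]
  by_cases h1 : d = cc x
  · subst h1
    have e : cc x ≠ cc x - 1 := by omega
    simp [h, e]
  · by_cases h2 : d = cc x + 1
    · subst h2
      have e : cc x + 1 ≠ cc x - 1 := by omega
      have e' : cc x + 1 + 1 ≠ cc x := by omega
      simp [h, e, e']; ring
    · by_cases h3 : d = cc x - 1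
      · subst h3
        have e : cc x - 1 ≠ cc x + 1 := by omega
        simp [h, e]
      · have e : d + 1 ≠ cc x := by omega
        simp [h1, h2, h3, e]

lemma DD_addCell (i : ZMod ℓ) {μ : YoungDiagram} {x : ℕ × ℕ} (hx : IsAddableCell μ x) (h : ℤ → ℤ) :
    DD ℓ i (addCell μ x) h = DD ℓ i μ h
      + (if ((cc x + 1 : ℤ) : ZMod ℓ) = i then h (cc x + 1) else 0)
      + (if ((cc x - 1 : ℤ) : ZMod ℓ) = i then h (cc x - 1) else 0)
      - 2 * (if ((cc x : ℤ) : ZMod ℓ) = i then h (cc x) else 0) := by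
  have hb := addable_bound μ x hx
  have hc : (addCell μ x).cells.card = μ.cells.card + 1 := by
    rw [addCell_cells hx, Finset.card_insert_of_notMem hx.1]
  unfold DD
  rw [sum_eq ℓ i μ h (μ.cells.card + 3) (by omega),
    sum_eq ℓ i (addCell μ x) h (μ.cells.card + 3) (by rw [hc]; push_cast; omega)]
  have key : ∀ a : ℤ, a ∈ Finset.Icc (-((μ.cells.card : ℤ) + 3)) ((μ.cells.card : ℤ) + 3) →
      ∑ d ∈ (Finset.Icc (-((μ.cells.card : ℤ) + 3)) ((μ.cells.card : ℤ) + 3)).filter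
        (fun d : ℤ => (d : ZMod ℓ) = i), (if d = a then 1 else 0) * h d
      = if (a : ZMod ℓ) = i then h a else 0 := by
    intro a ha
    simp only [ite_mul, one_mul, zero_mul, Finset.sum_ite_eq', Finset.mem_filter, ha, true_and]
  rw [← key (cc x + 1) (by simp only [Finset.mem_Icc, cc]; omega),
    ← key (cc x - 1) (by simp only [Finset.mem_Icc, cc]; omega),
    ← key (cc x) (by simp only [Finset.mem_Icc, cc]; omega), Finset.mul_sum,
    ← Finset.sum_add_distrib, ← Finset.sum_add_distrib, ← Finset.sum_sub_distrib]
  refine Finset.sum_congr rfl fun d _ => ?_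
  rw [gg_addCell hx]
  simp only [Int.cast_id]
  ring

lemma card_eq_DD (i : ZMod ℓ) (μ : YoungDiagram) (P : ℕ × ℕ → Prop) [DecidablePred P] (h : ℤ → ℤ)
    (hA : ∀ y, IsAddableCell μ y → ((cc y : ℤ) : ZMod ℓ) = i → h (cc y) = if P y then 1 else 0)
    (hR : ∀ y, IsRemovableCell μ y → ((cc y : ℤ) : ZMod ℓ) = i → h (cc y) = if P y then 1 else 0) :
    (((addables ℓ i μ).filter P).card : ℤ) - (((removables ℓ i μ).filter P).card : ℤ)
      = DD ℓ i μ h := by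
  unfold DD
  rw [Finset.card_filter, Finset.card_filter]
  push_cast
  congr 1
  · refine Finset.sum_congr rfl fun y hy => ?_
    rw [mem_addables] at hy
    rw [hA y hy.1 hy.2]
  · refine Finset.sum_congr rfl fun y hy => ?_
    rw [mem_removables] at hy
    rw [hR y hy.1 hy.2]

lemma Nstat_eq (i : ZMod ℓ) (μ : YoungDiagram) : Nstat ℓ i μ = DD ℓ i μ (fun _ => 1) := by
  unfold Nstat DD
  simp

lemma Na_eq (i : ZMod ℓ) {μ : YoungDiagram} {x : ℕ × ℕ} (hx : IsAddableCell μ x) :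
    Na ℓ i μ x = DD ℓ i μ (fun d => if cc x < d then 1 else 0) := by
  unfold Na
  rw [addable_iff] at hx
  apply card_eq_DD
  · intro y hy _
    rw [addable_iff] at hy
    refine if_congr ?_ rfl rfl
    simp only [cc]
    constructor
    · intro h
      by_contra hlt
      have := μ.rowLen_anti x.1 y.1 (by omega)
      omega
    · intro h
      have := hx.2 y.1 h
      omega
  · intro y hy _
    rw [removable_iff] at hy
    refine if_congr ?_ rfl rfl
    simp only [cc]
    constructor
    · intro h
      by_contra hlt
      have := μ.rowLen_anti x.1 y.1 (by omega)
      omega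
    · intro h
      have := hx.2 y.1 h
      omega

lemma one_ne (hℓ : 2 ≤ ℓ) : (1 : ZMod ℓ) ≠ 0 := by
  have : Fact (1 < ℓ) := ⟨by omega⟩
  exact one_ne_zero

lemma Nb_eq (hℓ : 2 ≤ ℓ) (i : ZMod ℓ) {μ : YoungDiagram} {x : ℕ × ℕ} (hx : IsAddableCell μ x)
    (hi : ((cc x : ℤ) : ZMod ℓ) = i) :
    Nb ℓ i μ x = DD ℓ i μ (fun d => if d < cc x then 1 else 0) := by
  unfold Nb
  rw [addable_iff] at hx
  apply card_eq_DD
  · intro y hy _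
    rw [addable_iff] at hy
    refine if_congr ?_ rfl rfl
    simp only [cc]
    constructor
    · intro h
      by_contra hlt
      rcases Nat.lt_or_ge y.1 x.1 with h1 | h1
      · have := hx.2 y.1 h1
        omega
      · have h2 : y.1 = x.1 := by omega
        have h3 := hy.1
        rw [h2] at h3
        omega
    · intro h
      have := hy.2 x.1 h
      omega
  · intro y hy hyi
    have hne : cc y + 1 ≠ cc x := by
      intro h
      rw [← h, ← hyi] at hi
      push_cast at hi
      exact one_ne ℓ hℓ (by simpa using hi)
    rw [removable_iff] at hy
    simp only [cc] at hne
    refine if_congr ?_ rfl rfl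
    simp only [cc]
    constructor
    · intro h
      by_contra hlt
      rcases Nat.lt_or_ge y.1 x.1 with h1 | h1
      · have := hx.2 y.1 h1
        omega
      · have h2 : y.1 = x.1 := by omega
        have h3 := hy.1
        rw [h2] at h3
        omega
    · intro h
      have := μ.rowLen_anti x.1 y.1 h.le
      omega

lemma cartan_eq (hℓ : 2 ≤ ℓ) (i : ZMod ℓ) (c : ℤ) :
    (if ((c + 1 : ℤ) : ZMod ℓ) = i then (1 : ℤ) else 0)
      + (if ((c - 1 : ℤ) : ZMod ℓ) = i then 1 else 0)
      - 2 * (if (c : ZMod ℓ) = i then 1 else 0) = - cartan ℓ i (c : ZMod ℓ) := by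
  have h10 := one_ne ℓ hℓ
  push_cast
  generalize (c : ZMod ℓ) = j
  unfold cartan
  by_cases hij : i = j
  · subst hij
    simp [h10]
  · rw [if_neg hij, if_neg (Ne.symm hij)]
    by_cases h2 : ℓ = 2
    · subst h2
      have : ∀ i j : ZMod 2, i ≠ j → j + 1 = i ∧ j - 1 = i := by decide
      simp [this i j hij]
    · rw [if_neg h2]
      have h20 : (2 : ZMod ℓ) ≠ 0 := by
        intro h
        have h3 : ((2 : ℕ) : ZMod ℓ) = 0 := by exact_mod_cast h
        rw [ZMod.natCast_eq_zero_iff] at h3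
        have := Nat.le_of_dvd (by norm_num) h3
        omega
      have hne : j + 1 ≠ j - 1 := by
        intro h
        apply h20
        linear_combination h
      by_cases ha : j + 1 = i
      · subst ha
        simp [hne.symm]
      · by_cases hb : j - 1 = i
        · subst hb
          simp [hne]
        · simp [ha, hb, Ne.symm ha, Ne.symm hb]

lemma cartan_symm (i j : ZMod ℓ) : cartan ℓ i j = cartan ℓ j i := by
  unfold cartan
  have h1 : i = j ↔ j = i := eq_comm
  have h2 : (i = j + 1 ∨ i = j - 1) ↔ (j = i + 1 ∨ j = i - 1) := by
    constructor <;> rintro (h | h) <;> subst h <;> simp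
  simp only [h1, h2]

lemma Nstat_addCell (hℓ : 2 ≤ ℓ) (i : ZMod ℓ) {μ : YoungDiagram} {x : ℕ × ℕ}
    (hx : IsAddableCell μ x) :
    Nstat ℓ i (addCell μ x) = Nstat ℓ i μ - cartan ℓ i (cc x : ZMod ℓ) := by
  rw [Nstat_eq, Nstat_eq, DD_addCell ℓ i hx]
  have := cartan_eq ℓ hℓ i (cc x)
  linarith

lemma Na_addCell_self (hℓ : 2 ≤ ℓ) {μ : YoungDiagram} {x : ℕ × ℕ} (hx : IsAddableCell μ x) :
    DD ℓ (cc x : ZMod ℓ) (addCell μ x) (fun d => if cc x < d then 1 else 0)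
     = DD ℓ (cc x : ZMod ℓ) μ (fun d => if cc x < d then 1 else 0) := by
  rw [DD_addCell ℓ _ hx]
  simp [one_ne ℓ hℓ]

lemma Nb_addCell_self (hℓ : 2 ≤ ℓ) {μ : YoungDiagram} {x : ℕ × ℕ} (hx : IsAddableCell μ x) :
    DD ℓ (cc x : ZMod ℓ) (addCell μ x) (fun d => if d < cc x then 1 else 0)
     = DD ℓ (cc x : ZMod ℓ) μ (fun d => if d < cc x then 1 else 0) := by
  rw [DD_addCell ℓ _ hx]
  simp [one_ne ℓ hℓ]

/-- the off-diagonal exponent identity -/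
lemma off_diag (hℓ : 2 ≤ ℓ) {ν : YoungDiagram} {x y : ℕ × ℕ} (hx : IsAddableCell ν x)
    (hy : IsAddableCell ν y) (hxy : x ≠ y) (hx' : IsAddableCell (addCell ν y) x)
    (hy' : IsAddableCell (addCell ν x) y) (i j : ZMod ℓ) (hj : (cc x : ZMod ℓ) = j)
    (hi : (cc y : ZMod ℓ) = i) :
    Nb ℓ j (addCell ν y) x - Na ℓ i (addCell ν x) y = - Na ℓ i ν y + Nb ℓ j ν x := by
  rw [Nb_eq ℓ hℓ j hx' hj, Na_eq ℓ i hy', Na_eq ℓ i hy, Nb_eq ℓ hℓ j hx hj,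
    DD_addCell ℓ _ hx, DD_addCell ℓ _ hy]
  have h0 : cc x ≠ cc y := fun h => hxy (addable_inj ν hx hy h)
  have hxs := (addable_SS ν (cc x)).1 ⟨x, hx, rfl⟩
  have hys := (addable_SS ν (cc y)).1 ⟨y, hy, rfl⟩
  have h1 : cc x ≠ cc y + 1 := fun h => hys.2 (h ▸ hxs.1)
  have h2 : cc y ≠ cc x + 1 := fun h => hxs.2 (h ▸ hys.1)
  have e1 := cartan_eq ℓ hℓ j (cc y)
  have e2 := cartan_eq ℓ hℓ i (cc x)
  rw [hi, cartan_symm] at e1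
  rw [hj, ← e1] at e2
  rw [hj, hi]
  rcases lt_or_gt_of_ne h0 with h | h
  · have a1 : ¬ cc y + 1 < cc x := by omega
    have a2 : ¬ cc y - 1 < cc x := by omega
    have a3 : ¬ cc y < cc x := by omega
    have b1 : ¬ cc y < cc x + 1 := by omega
    have b2 : ¬ cc y < cc x - 1 := by omega
    simp only [a1, a2, a3, b1, b2, if_false, ite_self]
    ring
  · have a1 : cc y + 1 < cc x := by omega
    have a2 : cc y - 1 < cc x := by omega
    have a3 : cc y < cc x := by omega
    have b1 : cc y < cc x + 1 := by omega
    have b2 : cc y < cc x - 1 := by omega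
    simp only [a1, a2, a3, b1, b2, if_true]
    linarith

lemma qq_ne : qq ≠ 0 := RatFunc.X_ne_zero

lemma qq_sub_ne : qq - qq⁻¹ ≠ 0 := by
  intro h
  have h1 : qq * qq = 1 := by
    have h2 := qq_ne
    rw [sub_eq_zero] at h
    nth_rw 2 [h]
    exact mul_inv_cancel₀ h2
  have h2 : (algebraMap (Polynomial ℚ) Fq) (Polynomial.X * Polynomial.X) =
      algebraMap (Polynomial ℚ) Fq 1 := by
    rw [map_mul, map_one, RatFunc.algebraMap_X]; exact h1
  have h3 := RatFunc.algebraMap_injective ℚ h2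
  have h4 := congrArg (Polynomial.eval 0) h3
  simp at h4

lemma gg_cases (μ : YoungDiagram) (d : ℤ) : gg μ d = 0 ∨ gg μ d = 1 ∨ gg μ d = -1 := by
  unfold gg
  split_ifs <;> simp

lemma gg_q (g : ℤ) (hg : g = 0 ∨ g = 1 ∨ g = -1) :
    (qq - qq⁻¹) * (g : Fq) = qq ^ g - qq ^ (-g) := by
  rcases hg with h | h | h <;> subst h <;> simp

lemma telescope (g : ℤ → ℤ) (hg : ∀ d, g d = 0 ∨ g d = 1 ∨ g d = -1) (T : Finset ℤ) :
    (qq - qq⁻¹) * ∑ d ∈ T, (g d : Fq) *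
        qq ^ ((∑ e ∈ T, g e * if e < d then 1 else 0) - ∑ e ∈ T, g e * if d < e then 1 else 0)
      = qq ^ (∑ d ∈ T, g d) - qq ^ (-∑ d ∈ T, g d) := by
  induction T using Finset.induction_on_max with
  | empty => simp
  | insert a s hs ih =>
    have ha : a ∉ s := fun h => lt_irrefl _ (hs a h)
    have hq := qq_ne
    rw [Finset.sum_insert ha, Finset.sum_insert (f := g) ha]
    have t1 : (∑ e ∈ insert a s, g e * if e < a then 1 else 0) = ∑ e ∈ s, g e := by
      rw [Finset.sum_insert ha]
      simp only [lt_irrefl, if_false, mul_zero, zero_add]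
      refine Finset.sum_congr rfl fun e he => ?_
      rw [if_pos (hs e he), mul_one]
    have t2 : (∑ e ∈ insert a s, g e * if a < e then 1 else 0) = 0 := by
      rw [Finset.sum_insert ha]
      simp only [lt_irrefl, if_false, mul_zero, zero_add]
      refine Finset.sum_eq_zero fun e he => ?_
      rw [if_neg (by have := hs e he; omega), mul_zero]
    have t3 : ∑ d ∈ s, (g d : Fq) * qq ^ ((∑ e ∈ insert a s, g e * if e < d then 1 else 0)
          - ∑ e ∈ insert a s, g e * if d < e then 1 else 0)
        = qq ^ (-g a) * ∑ d ∈ s, (g d : Fq) * qq ^ ((∑ e ∈ s, g e * if e < d then 1 else 0)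
          - ∑ e ∈ s, g e * if d < e then 1 else 0) := by
      rw [Finset.mul_sum]
      refine Finset.sum_congr rfl fun d hd => ?_
      rw [Finset.sum_insert ha, Finset.sum_insert ha, if_neg (by have := hs d hd; omega),
        if_pos (hs d hd)]
      rw [mul_left_comm, ← zpow_add₀ hq]
      congr 2
      ring
    rw [t1, t2, t3, mul_add, mul_left_comm _ (qq ^ (-g a)), ih, ← mul_assoc, gg_q _ (hg a), sub_zero,
      neg_add, zpow_add₀ hq, zpow_add₀ hq]
    ring

lemma DD_eq (i : ZMod ℓ) (μ : YoungDiagram) (h : ℤ → ℤ) : DD ℓ i μ h =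
    ∑ d ∈ (Finset.Icc (-(μ.cells.card : ℤ)) μ.cells.card).filter
      (fun d : ℤ => (d : ZMod ℓ) = i), gg μ d * h d :=
  sum_eq ℓ i μ h μ.cells.card le_rfl

lemma diag (i : ZMod ℓ) (μ : YoungDiagram) :
    (∑ x ∈ addables ℓ i μ, qq ^ (DD ℓ i μ (fun d => if d < cc x then 1 else 0)
          - DD ℓ i μ (fun d => if cc x < d then 1 else 0)))
      - (∑ x ∈ removables ℓ i μ, qq ^ (DD ℓ i μ (fun d => if d < cc x then 1 else 0)
          - DD ℓ i μ (fun d => if cc x < d then 1 else 0)))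
      = (qq - qq⁻¹)⁻¹ * (qq ^ (Nstat ℓ i μ) - qq ^ (-Nstat ℓ i μ)) := by
  rw [sum_eq ℓ i μ (fun c => qq ^ (DD ℓ i μ (fun d => if d < c then 1 else 0)
          - DD ℓ i μ (fun d => if c < d then 1 else 0))) μ.cells.card le_rfl, Nstat_eq]
  simp only [DD_eq]
  rw [eq_inv_mul_iff_mul_eq₀ qq_sub_ne]
  simp only [mul_one]
  exact telescope (gg μ) (gg_cases μ) _

lemma Eop_single (i : ZMod ℓ) (μ : YoungDiagram) : Eop ℓ i (Finsupp.single μ 1) =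
    ∑ x ∈ removables ℓ i μ,
      (qq ^ (-(Na ℓ i (eraseCell μ x) x))) • Finsupp.single (eraseCell μ x) (1 : Fq) := by
  unfold Eop
  rw [Finsupp.linearCombination_single, one_smul]

lemma Fop_single (i : ZMod ℓ) (μ : YoungDiagram) : Fop ℓ i (Finsupp.single μ 1) =
    ∑ x ∈ addables ℓ i μ,
      (qq ^ (Nb ℓ i μ x)) • Finsupp.single (addCell μ x) (1 : Fq) := by
  unfold Fop
  rw [Finsupp.linearCombination_single, one_smul]

lemma Kop_single (i : ZMod ℓ) (μ : YoungDiagram) : Kop ℓ i (Finsupp.single μ 1) =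
    (qq ^ (Nstat ℓ i μ)) • Finsupp.single μ (1 : Fq) := by
  unfold Kop
  rw [Finsupp.linearCombination_single, one_smul]

lemma Kinvop_single (i : ZMod ℓ) (μ : YoungDiagram) : Kinvop ℓ i (Finsupp.single μ 1) =
    (qq ^ (-(Nstat ℓ i μ))) • Finsupp.single μ (1 : Fq) := by
  unfold Kinvop
  rw [Finsupp.linearCombination_single, one_smul]

lemma end_ext {A B : Module.End Fq Fock}
    (h : ∀ μ, A (Finsupp.single μ 1) = B (Finsupp.single μ 1)) : A = B :=
  Finsupp.lhom_ext' fun μ => LinearMap.ext_ring (h μ)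

lemma swap_iff (μ : YoungDiagram) (x y : ℕ × ℕ) :
    (IsAddableCell μ x ∧ IsRemovableCell (addCell μ x) y ∧ y ≠ x) ↔
    (IsAddableCell (eraseCell μ y) x ∧ x ≠ y ∧ IsRemovableCell μ y) := by
  constructor
  · rintro ⟨hx, hy, hne⟩
    have hym : y ∈ μ.cells := by
      have := hy.1
      rw [← YoungDiagram.mem_cells, addCell_cells hx, Finset.mem_insert] at this
      exact this.resolve_left hne
    have hxm : x ∉ μ.cells := hx.1
    have hl := hy.2
    rw [addCell_cells hx] at hl
    have hy' : IsRemovableCell μ y := by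
      refine ⟨hym, ?_⟩
      have := hl.inter μ.isLowerSet
      convert this using 1
      ext z
      simp only [Finset.coe_erase, Finset.coe_insert, Set.mem_sdiff, Set.mem_inter_iff,
        Set.mem_insert_iff, Set.mem_singleton_iff, Finset.mem_coe]
      tauto
    refine ⟨⟨?_, ?_⟩, hne.symm, hy'⟩
    · rw [← YoungDiagram.mem_cells, eraseCell_cells hy']
      exact fun h => hxm (Finset.mem_of_mem_erase h)
    · rw [eraseCell_cells hy', ← Finset.coe_insert, ← Finset.erase_insert_of_ne hne.symm]
      exact hl
  · rintro ⟨hx, hne, hy⟩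
    have hxm : x ∉ μ.cells := by
      have := hx.1
      rw [← YoungDiagram.mem_cells, eraseCell_cells hy] at this
      exact fun h => this (Finset.mem_erase.2 ⟨hne, h⟩)
    have hym : y ∈ μ.cells := hy.1
    have hl := hx.2
    rw [eraseCell_cells hy] at hl
    have hx' : IsAddableCell μ x := by
      refine ⟨hxm, ?_⟩
      have := hl.union μ.isLowerSet
      convert this using 1
      ext z
      simp only [Finset.coe_erase, Set.mem_sdiff, Set.mem_union,
        Set.mem_insert_iff, Set.mem_singleton_iff, Finset.mem_coe]
      tauto
    refine ⟨hx', ⟨?_, ?_⟩, hne.symm⟩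
    · rw [← YoungDiagram.mem_cells, addCell_cells hx']
      exact Finset.mem_insert_of_mem hym
    · rw [addCell_cells hx', Finset.erase_insert_of_ne hne, Finset.coe_insert]
      exact hl

lemma erase_addCell_comm {μ : YoungDiagram} {x y : ℕ × ℕ} (hx : IsAddableCell μ x)
    (hy : IsRemovableCell (addCell μ x) y) (hne : y ≠ x) :
    eraseCell (addCell μ x) y = addCell (eraseCell μ y) x := by
  obtain ⟨hx', _, hy'⟩ := (swap_iff μ x y).1 ⟨hx, hy, hne⟩
  apply YoungDiagram.ext
  rw [eraseCell_cells hy, addCell_cells hx, addCell_cells hx', eraseCell_cells hy',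
    Finset.erase_insert_of_ne hne.symm]

lemma EF_single (i j : ZMod ℓ) (μ : YoungDiagram) :
    Eop ℓ i (Fop ℓ j (Finsupp.single μ 1)) =
      (∑ x ∈ addables ℓ j μ, ∑ y ∈ (removables ℓ i (addCell μ x)).erase x,
        qq ^ (Nb ℓ j μ x - Na ℓ i (eraseCell (addCell μ x) y) y) •
          Finsupp.single (eraseCell (addCell μ x) y) (1 : Fq))
      + if i = j then (∑ x ∈ addables ℓ i μ, qq ^ (Nb ℓ i μ x - Na ℓ i μ x)) •
          Finsupp.single μ (1 : Fq) else 0 := by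
  have h0 : (if i = j then (∑ x ∈ addables ℓ i μ, qq ^ (Nb ℓ i μ x - Na ℓ i μ x)) •
          Finsupp.single μ (1 : Fq) else 0) = ∑ x ∈ addables ℓ j μ,
          if i = j then qq ^ (Nb ℓ i μ x - Na ℓ i μ x) • Finsupp.single μ (1 : Fq) else 0 := by
    split_ifs with h
    · subst h; rw [Finset.sum_smul]
    · simp
  rw [h0, Fop_single, map_sum, ← Finset.sum_add_distrib]
  refine Finset.sum_congr rfl fun x hx => ?_
  rw [mem_addables] at hx
  rw [map_smul, Eop_single, Finset.smul_sum]
  simp only [smul_smul, ← zpow_add₀ qq_ne, ← sub_eq_add_neg]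
  by_cases h : i = j
  · subst h
    have hm : x ∈ removables ℓ i (addCell μ x) := by
      rw [mem_removables]; exact ⟨removable_addCell hx.1, hx.2⟩
    rw [if_pos rfl, ← Finset.sum_erase_add _ _ hm, erase_add hx.1]
  · have hm : x ∉ removables ℓ i (addCell μ x) := by
      rw [mem_removables]; rintro ⟨_, h2⟩; exact h (h2.symm.trans hx.2)
    rw [if_neg h, Finset.erase_eq_of_notMem hm, add_zero]

lemma FE_single (i j : ZMod ℓ) (μ : YoungDiagram) :
    Fop ℓ j (Eop ℓ i (Finsupp.single μ 1)) =
      (∑ y ∈ removables ℓ i μ, ∑ x ∈ (addables ℓ j (eraseCell μ y)).erase y,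
        qq ^ (-Na ℓ i (eraseCell μ y) y + Nb ℓ j (eraseCell μ y) x) •
          Finsupp.single (addCell (eraseCell μ y) x) (1 : Fq))
      + if i = j then (∑ y ∈ removables ℓ i μ,
          qq ^ (-Na ℓ i (eraseCell μ y) y + Nb ℓ i (eraseCell μ y) y)) •
          Finsupp.single μ (1 : Fq) else 0 := by
  have h0 : (if i = j then (∑ y ∈ removables ℓ i μ,
          qq ^ (-Na ℓ i (eraseCell μ y) y + Nb ℓ i (eraseCell μ y) y)) •
          Finsupp.single μ (1 : Fq) else 0) = ∑ y ∈ removables ℓ i μ,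
          if i = j then qq ^ (-Na ℓ i (eraseCell μ y) y + Nb ℓ i (eraseCell μ y) y) •
            Finsupp.single μ (1 : Fq) else 0 := by
    split_ifs with h
    · subst h; rw [Finset.sum_smul]
    · simp
  rw [h0, Eop_single, map_sum, ← Finset.sum_add_distrib]
  refine Finset.sum_congr rfl fun y hy => ?_
  rw [mem_removables] at hy
  rw [map_smul, Fop_single, Finset.smul_sum]
  simp only [smul_smul, ← zpow_add₀ qq_ne]
  by_cases h : i = j
  · subst h
    have hm : y ∈ addables ℓ i (eraseCell μ y) := by
      rw [mem_addables]; exact ⟨addable_eraseCell hy.1, hy.2⟩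
    rw [if_pos rfl, ← Finset.sum_erase_add _ _ hm, add_erase hy.1]
  · have hm : y ∉ addables ℓ j (eraseCell μ y) := by
      rw [mem_addables]; rintro ⟨_, h2⟩; exact h (hy.2.symm.trans h2)
    rw [if_neg h, Finset.erase_eq_of_notMem hm, add_zero]

lemma off_sum (hℓ : 2 ≤ ℓ) (i j : ZMod ℓ) (μ : YoungDiagram) :
    (∑ x ∈ addables ℓ j μ, ∑ y ∈ (removables ℓ i (addCell μ x)).erase x,
        qq ^ (Nb ℓ j μ x - Na ℓ i (eraseCell (addCell μ x) y) y) •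
          Finsupp.single (eraseCell (addCell μ x) y) (1 : Fq))
    = ∑ y ∈ removables ℓ i μ, ∑ x ∈ (addables ℓ j (eraseCell μ y)).erase y,
        qq ^ (-Na ℓ i (eraseCell μ y) y + Nb ℓ j (eraseCell μ y) x) •
          Finsupp.single (addCell (eraseCell μ y) x) (1 : Fq) := by
  rw [Finset.sum_comm' (t' := removables ℓ i μ)
    (s' := fun y => (addables ℓ j (eraseCell μ y)).erase y)]
  · refine Finset.sum_congr rfl fun y hy => Finset.sum_congr rfl fun x hx => ?_
    rw [mem_removables] at hy
    rw [Finset.mem_erase, mem_addables] at hx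
    obtain ⟨hne, hx, hj⟩ := hx
    obtain ⟨hy, hi⟩ := hy
    obtain ⟨hx2, hy2, _⟩ := (swap_iff μ x y).2 ⟨hx, hne, hy⟩
    have hcomm := erase_addCell_comm hx2 hy2 hne.symm
    have hy3 := addable_eraseCell hy2
    rw [hcomm] at hy3 ⊢
    have hmu := add_erase hy
    have key := off_diag ℓ hℓ hx (addable_eraseCell hy) hne (by rw [hmu]; exact hx2) hy3 i j hj hi
    rw [hmu] at key
    rw [key]
  · intro x y
    rw [Finset.mem_erase, Finset.mem_erase, mem_addables, mem_removables, mem_addables,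
      mem_removables]
    have := swap_iff μ x y
    tauto

lemma diag_term (hℓ : 2 ≤ ℓ) (i : ZMod ℓ) (μ : YoungDiagram) :
    (∑ x ∈ addables ℓ i μ, qq ^ (Nb ℓ i μ x - Na ℓ i μ x))
      - (∑ y ∈ removables ℓ i μ, qq ^ (-Na ℓ i (eraseCell μ y) y + Nb ℓ i (eraseCell μ y) y))
    = (qq - qq⁻¹)⁻¹ * (qq ^ (Nstat ℓ i μ) - qq ^ (-Nstat ℓ i μ)) := by
  rw [← diag ℓ i μ]
  congr 1
  · refine Finset.sum_congr rfl fun x hx => ?_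
    rw [mem_addables] at hx
    rw [Nb_eq ℓ hℓ i hx.1 hx.2, Na_eq ℓ i hx.1]
  · refine Finset.sum_congr rfl fun y hy => ?_
    rw [mem_removables] at hy
    obtain ⟨hy, hi⟩ := hy
    have ha := addable_eraseCell hy
    rw [Nb_eq ℓ hℓ i ha hi, Na_eq ℓ i ha]
    subst hi
    have e1 := Na_addCell_self ℓ hℓ ha
    have e2 := Nb_addCell_self ℓ hℓ ha
    rw [add_erase hy] at e1 e2
    rw [e1, e2, neg_add_eq_sub]

/-- Hayashi realization of the Fock space: Cartan-type relations.
The operators `E_i, F_i, K_i^{±1}` on the Fock space satisfy: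
`K_i K_j = K_j K_i`, `K_i K_i⁻¹ = K_i⁻¹ K_i = 1`, `K_i E_j = q^{a_{ij}} E_j K_i`,
`K_i F_j = q^{-a_{ij}} F_j K_i`, and
`E_i F_j - F_j E_i = δ_{ij} (K_i - K_i⁻¹)/(q - q⁻¹)`. -/
theorem statement9 (hℓ : 2 ≤ ℓ) :
    (∀ i j : ZMod ℓ, Kop ℓ i * Kop ℓ j = Kop ℓ j * Kop ℓ i)
    ∧ (∀ i : ZMod ℓ, Kop ℓ i * Kinvop ℓ i = 1 ∧ Kinvop ℓ i * Kop ℓ i = 1)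
    ∧ (∀ i j : ZMod ℓ, Kop ℓ i * Eop ℓ j = (qq ^ cartan ℓ i j) • (Eop ℓ j * Kop ℓ i))
    ∧ (∀ i j : ZMod ℓ, Kop ℓ i * Fop ℓ j = (qq ^ (-(cartan ℓ i j))) • (Fop ℓ j * Kop ℓ i))
    ∧ (∀ i j : ZMod ℓ,
        Eop ℓ i * Fop ℓ j - Fop ℓ j * Eop ℓ i
          = if i = j then (qq - qq⁻¹)⁻¹ • (Kop ℓ i - Kinvop ℓ i) else 0) := by
  refine ⟨?_, ?_, ?_, ?_, ?_⟩
  · intro i j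
    refine end_ext fun μ => ?_
    simp only [Module.End.mul_apply, Kop_single, map_smul, smul_smul]
    rw [mul_comm]
  · intro i
    have hq : ∀ n : ℤ, qq ^ n * qq ^ (-n) = 1 := fun n => by
      rw [← zpow_add₀ qq_ne, add_neg_cancel, zpow_zero]
    constructor
    · refine end_ext fun μ => ?_
      simp only [Module.End.mul_apply, Kop_single, Kinvop_single, map_smul, smul_smul]
      rw [mul_comm, hq, one_smul, Module.End.one_apply]
    · refine end_ext fun μ => ?_
      simp only [Module.End.mul_apply, Kop_single, Kinvop_single, map_smul, smul_smul]
      rw [hq, one_smul, Module.End.one_apply]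
  · intro i j
    refine end_ext fun μ => ?_
    simp only [Module.End.mul_apply, LinearMap.smul_apply, Kop_single, Eop_single, map_smul,
      map_sum, Finset.smul_sum, smul_smul]
    refine Finset.sum_congr rfl fun y hy => ?_
    rw [mem_removables] at hy
    have h := Nstat_addCell ℓ hℓ i (addable_eraseCell hy.1)
    rw [add_erase hy.1, hy.2] at h
    simp only [← zpow_add₀ qq_ne]
    congr 2
    linarith
  · intro i j
    refine end_ext fun μ => ?_
    simp only [Module.End.mul_apply, LinearMap.smul_apply, Kop_single, Fop_single, map_smul,
      map_sum, Finset.smul_sum, smul_smul]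
    refine Finset.sum_congr rfl fun x hx => ?_
    rw [mem_addables] at hx
    have h := Nstat_addCell ℓ hℓ i hx.1
    rw [hx.2] at h
    simp only [← zpow_add₀ qq_ne]
    congr 2
    linarith
  · intro i j
    refine end_ext fun μ => ?_
    rw [LinearMap.sub_apply, Module.End.mul_apply, Module.End.mul_apply, EF_single, FE_single,
      off_sum ℓ hℓ, add_sub_add_left_eq_sub]
    split_ifs with h
    · rw [← sub_smul, diag_term ℓ hℓ, LinearMap.smul_apply, LinearMap.sub_apply, Kop_single,
        Kinvop_single, ← sub_smul, smul_smul]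
    · simp

end FockSpace
end
end

section
/- For all partitions λ, μ and every i ∈ Z/ℓ: ẽ_i λ = μ if and only if f̃_i μ = λ. In particular ẽ_i and f̃_i are mutually inverse partial bijections on the set of partitions; this is the combinatorial content of the Misra–Miwa description of the crystal of the Fock space of U_q(ŝl_ℓ). -/
noncomputable section

open scoped BigOperators Classical

namespace FockCrystal

variable (ℓ : ℕ)

/-- The `ℓ`-residue of a cell `(r, c)` (0-indexed rows and columns): `(c - r) mod ℓ`. -/
def res (x : ℕ × ℕ) : ZMod ℓ := (((x.2 : ℤ) - (x.1 : ℤ) : ℤ) : ZMod ℓ)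

/-- `x` is an addable cell of `μ`: `x ∉ μ` and `μ ∪ {x}` is again a Young diagram. -/
def IsAddableCell (μ : YoungDiagram) (x : ℕ × ℕ) : Prop :=
  x ∉ μ ∧ IsLowerSet (insert x (μ.cells : Set (ℕ × ℕ)))

/-- `x` is a removable cell of `μ`: `x ∈ μ` and `μ \ {x}` is again a Young diagram. -/
def IsRemovableCell (μ : YoungDiagram) (x : ℕ × ℕ) : Prop :=
  x ∈ μ ∧ IsLowerSet ((μ.cells.erase x : Finset (ℕ × ℕ)) : Set (ℕ × ℕ))

/-- The finite set of `i`-addable cells of `μ`. -/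
def addables (i : ZMod ℓ) (μ : YoungDiagram) : Finset (ℕ × ℕ) :=
  (Finset.range (μ.cells.card + 1) ×ˢ Finset.range (μ.cells.card + 1)).filter
    fun x => IsAddableCell μ x ∧ res ℓ x = i

/-- The finite set of `i`-removable cells of `μ`. -/
def removables (i : ZMod ℓ) (μ : YoungDiagram) : Finset (ℕ × ℕ) :=
  μ.cells.filter fun x => IsRemovableCell μ x ∧ res ℓ x = i

/-- Adding a cell to a Young diagram (returns `μ` unchanged if the result would not be a
Young diagram). -/
def addCell (μ : YoungDiagram) (x : ℕ × ℕ) : YoungDiagram :=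
  if h : IsLowerSet (insert x (μ.cells : Set (ℕ × ℕ))) then
    ⟨insert x μ.cells, by simpa using h⟩
  else μ

/-- Removing a cell from a Young diagram (returns `μ` unchanged if the result would not be
a Young diagram). -/
def eraseCell (μ : YoungDiagram) (x : ℕ × ℕ) : YoungDiagram :=
  if h : IsLowerSet ((μ.cells.erase x : Finset (ℕ × ℕ)) : Set (ℕ × ℕ)) then
    ⟨μ.cells.erase x, h⟩
  else μ

/-- The letter (`some true` = `A` for addable, `some false` = `R` for removable) contributed
to the `i`-word of `μ` by row `r`; for a fixed residue a row contributes at most one letter. -/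
def rowLetter (i : ZMod ℓ) (μ : YoungDiagram) (r : ℕ) : Option Bool :=
  if ∃ c, (r, c) ∈ addables ℓ i μ then some true
  else if ∃ c, (r, c) ∈ removables ℓ i μ then some false
  else none

/-- The `i`-word of `μ`, read from the bottom row up, with each letter recorded together
with its row index. -/
def wordP (i : ZMod ℓ) (μ : YoungDiagram) : List (Bool × ℕ) :=
  ((List.range (μ.cells.card + 2)).reverse).filterMap fun r =>
    (rowLetter ℓ i μ r).map fun b => (b, r)

/-- One step of the `AR`-cancellation (stack algorithm): an `R` cancels a directly
preceding `A`. -/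
def cancelStep (st : List (Bool × ℕ)) (c : Bool × ℕ) : List (Bool × ℕ) :=
  if c.1 = false ∧ (st.getLast?.map Prod.fst) = some true then st.dropLast else st ++ [c]

/-- Repeatedly delete adjacent occurrences of `AR` until none remain (computed by the
one-pass stack algorithm, which yields the unique `AR`-reduced word `R…RA…A`). -/
def reduceWord (w : List (Bool × ℕ)) : List (Bool × ℕ) := w.foldl cancelStep []

/-- The row of the `i`-good cell of `μ`: the removable cell corresponding to the rightmost
`R` remaining in the reduced `i`-word (if any). -/
def goodRow (i : ZMod ℓ) (μ : YoungDiagram) : Option ℕ :=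
  (((reduceWord (wordP ℓ i μ)).filter fun p => p.1 = false).getLast?).map Prod.snd

/-- The row of the `i`-cogood cell of `μ`: the addable cell corresponding to the leftmost
`A` remaining in the reduced `i`-word (if any). -/
def cogoodRow (i : ZMod ℓ) (μ : YoungDiagram) : Option ℕ :=
  (((reduceWord (wordP ℓ i μ)).filter fun p => p.1 = true).head?).map Prod.snd

/-- The Kashiwara operator `ẽᵢ`: remove the `i`-good cell if there is one, else `0`
(modelled by `Option`, `none = 0`). -/
def etilde (i : ZMod ℓ) (μ : YoungDiagram) : Option YoungDiagram :=
  (goodRow ℓ i μ).map fun r => eraseCell μ (r, μ.rowLen r - 1)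

/-- The Kashiwara operator `f̃ᵢ`: add the `i`-cogood cell if there is one, else `0`
(modelled by `Option`, `none = 0`). -/
def ftilde (i : ZMod ℓ) (μ : YoungDiagram) : Option YoungDiagram :=
  (cogoodRow ℓ i μ).map fun r => addCell μ (r, μ.rowLen r)

def rwf (f : ℕ → Option Bool) (L : List ℕ) : List (Bool × ℕ) :=
  L.filterMap fun r => (f r).map fun b => (b, r)

theorem cs_true (s : List (Bool × ℕ)) (k : ℕ) : cancelStep s (true, k) = s ++ [(true, k)] := by
  simp [cancelStep]

theorem cs_false_nil (P : List (Bool × ℕ)) (hP : ∀ p ∈ P, p.1 = false) (k : ℕ) :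
    cancelStep P (false, k) = P ++ [(false, k)] := by
  unfold cancelStep
  rw [if_neg]
  rintro ⟨-, h⟩
  rw [Option.map_eq_some_iff] at h
  obtain ⟨a, ha, hb⟩ := h
  have := hP a (List.mem_of_getLast? ha)
  simp_all

theorem cs_false_snoc (S : List (Bool × ℕ)) (j k : ℕ) :
    cancelStep (S ++ [(true, j)]) (false, k) = S := by
  simp [cancelStep]

/-- normal form -/
def NF (s P Q : List (Bool × ℕ)) : Prop :=
  s = P ++ Q ∧ (∀ p ∈ P, p.1 = false) ∧ (∀ p ∈ Q, p.1 = true)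

theorem snoc_true (Q : List (Bool × ℕ)) (hQ : ∀ p ∈ Q, p.1 = true) :
    Q = [] ∨ ∃ Q' j, Q = Q' ++ [(true, j)] ∧ ∀ p ∈ Q', p.1 = true := by
  rcases List.eq_nil_or_concat Q with h | ⟨Q', ⟨b, j⟩, h⟩
  · exact Or.inl h
  · right
    subst h
    have : b = true := hQ (b, j) (by simp)
    subst this
    exact ⟨Q', j, by simp, fun p hp => hQ p (by simp [hp])⟩

def DeadM (r : ℕ) (s : List (Bool × ℕ)) : Prop :=
  ∃ P Q, NF s P Q ∧ ∀ p, Q.head? = some p → p.2 ≠ r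

def DeadL (r : ℕ) (s : List (Bool × ℕ)) : Prop :=
  ∃ P Q, NF s P Q ∧ ∀ p, P.getLast? = some p → p.2 ≠ r

def GoodP (r : ℕ) (s t : List (Bool × ℕ)) : Prop :=
  ∃ P Q, (∀ p ∈ P, p.1 = false) ∧ (∀ p ∈ Q, p.1 = true) ∧
    s = P ++ (true, r) :: Q ∧ t = P ++ (false, r) :: Q

theorem DeadM.step {r : ℕ} {s : List (Bool × ℕ)} (h : DeadM r s) (c : Bool × ℕ) (hc : c.2 ≠ r) :
    DeadM r (cancelStep s c) := by
  obtain ⟨P, Q, ⟨rfl, hP, hQ⟩, hd⟩ := h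
  obtain ⟨b, k⟩ := c
  cases b
  · rcases snoc_true Q hQ with rfl | ⟨Q', j, rfl, hQ'⟩
    · refine ⟨P ++ [(false, k)], [], ⟨?_, ?_, ?_⟩, ?_⟩
      · simp [cs_false_nil P hP]
      · grind
      · simp
      · simp
    · refine ⟨P, Q', ⟨?_, hP, hQ'⟩, ?_⟩
      · rw [← List.append_assoc, cs_false_snoc]
      · intro p hp
        apply hd
        cases Q' <;> simp_all
  · refine ⟨P, Q ++ [(true, k)], ⟨?_, hP, ?_⟩, ?_⟩
    · rw [cs_true, List.append_assoc]
    · grind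
    · intro p hp
      cases Q with
      | nil => simp at hp; subst hp; exact hc
      | cons a Q => exact hd p (by simpa using hp)

theorem DeadL.step {r : ℕ} {s : List (Bool × ℕ)} (h : DeadL r s) (c : Bool × ℕ) (hc : c.2 ≠ r) :
    DeadL r (cancelStep s c) := by
  obtain ⟨P, Q, ⟨rfl, hP, hQ⟩, hd⟩ := h
  obtain ⟨b, k⟩ := c
  cases b
  · rcases snoc_true Q hQ with rfl | ⟨Q', j, rfl, hQ'⟩
    · refine ⟨P ++ [(false, k)], [], ⟨?_, ?_, ?_⟩, ?_⟩
      · simp [cs_false_nil P hP]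
      · grind
      · simp
      · intro p hp
        simp at hp; subst hp; exact hc
    · refine ⟨P, Q', ⟨?_, hP, hQ'⟩, hd⟩
      rw [← List.append_assoc, cs_false_snoc]
  · refine ⟨P, Q ++ [(true, k)], ⟨?_, hP, ?_⟩, hd⟩
    · rw [cs_true, List.append_assoc]
    · grind

theorem GoodP.step {r : ℕ} {s t : List (Bool × ℕ)} (h : GoodP r s t) (c : Bool × ℕ)
    (hc : c.2 ≠ r) : GoodP r (cancelStep s c) (cancelStep t c) ∨
      (DeadM r (cancelStep s c) ∧ DeadL r (cancelStep t c)) := by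
  obtain ⟨P, Q, hP, hQ, rfl, rfl⟩ := h
  obtain ⟨b, k⟩ := c
  cases b
  · rcases snoc_true Q hQ with rfl | ⟨Q', j, rfl, hQ'⟩
    · right
      constructor
      · refine ⟨P, [], ⟨?_, hP, by simp⟩, by simp⟩
        rw [cs_false_snoc]; simp
      · refine ⟨P ++ [(false, r)] ++ [(false, k)], [], ⟨?_, ?_, by simp⟩, ?_⟩
        · rw [cs_false_nil]
          · simp
          · grind
        · grind
        · intro p hp
          simp at hp; subst hp; exact hc
    · left
      refine ⟨P, Q', hP, hQ', ?_, ?_⟩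
      · rw [← List.cons_append, ← List.append_assoc, cs_false_snoc]
      · rw [← List.cons_append, ← List.append_assoc, cs_false_snoc]
  · left
    refine ⟨P, Q ++ [(true, k)], hP, ?_, ?_, ?_⟩
    · grind
    · simp [cs_true]
    · simp [cs_true]

theorem rel_foldl {r : ℕ} (v : List (Bool × ℕ)) (hv : ∀ c ∈ v, c.2 ≠ r) :
    ∀ {s t : List (Bool × ℕ)}, GoodP r s t ∨ (DeadM r s ∧ DeadL r t) →
      GoodP r (v.foldl cancelStep s) (v.foldl cancelStep t) ∨
        (DeadM r (v.foldl cancelStep s) ∧ DeadL r (v.foldl cancelStep t)) := by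
  induction v with
  | nil => intro s t h; exact h
  | cons c v ih =>
    intro s t h
    have hc := hv c (by simp)
    refine ih (fun d hd => hv d (by simp [hd])) ?_
    rcases h with h | ⟨h1, h2⟩
    · exact h.step c hc
    · exact Or.inr ⟨h1.step c hc, h2.step c hc⟩

theorem foldl_NF (v : List (Bool × ℕ)) : ∀ {s P Q : List (Bool × ℕ)}, NF s P Q →
    ∃ P' Q', NF (v.foldl cancelStep s) P' Q' ∧ ∀ p ∈ P' ++ Q', p ∈ s ∨ p ∈ v := by
  induction v with
  | nil => intro s P Q h; exact ⟨P, Q, h, fun p hp => Or.inl (h.1 ▸ hp)⟩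
  | cons c v ih =>
    rintro s P Q ⟨rfl, hP, hQ⟩
    have key : ∃ P' Q', NF (cancelStep (P ++ Q) c) P' Q' ∧ ∀ p ∈ P' ++ Q', p ∈ P ++ Q ∨ p = c := by
      obtain ⟨b, k⟩ := c
      cases b
      · rcases snoc_true Q hQ with rfl | ⟨Q', j, rfl, hQ'⟩
        · refine ⟨P ++ [(false, k)], [], ⟨by simp [cs_false_nil P hP], by grind, by simp⟩, by grind⟩
        · refine ⟨P, Q', ⟨?_, hP, hQ'⟩, by grind⟩
          rw [← List.append_assoc, cs_false_snoc]
      · refine ⟨P, Q ++ [(true, k)], ⟨?_, hP, by grind⟩, by grind⟩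
        rw [cs_true, List.append_assoc]
    obtain ⟨P1, Q1, h1, h2⟩ := key
    obtain ⟨P2, Q2, h3, h4⟩ := ih h1
    refine ⟨P2, Q2, h3, fun p hp => ?_⟩
    rcases h4 p hp with h | h
    · rw [h1.1] at h
      rcases h2 p h with h | h
      · exact Or.inl h
      · exact Or.inr (by simp [h])
    · exact Or.inr (by simp [h])

theorem mem_reduce {w : List (Bool × ℕ)} {p : Bool × ℕ} (h : p ∈ reduceWord w) : p ∈ w := by
  obtain ⟨P, Q, h1, h2⟩ := foldl_NF w (s := []) (P := []) (Q := []) ⟨rfl, by simp, by simp⟩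
  unfold reduceWord at h
  rw [h1.1] at h
  simpa using h2 p h

theorem NF.filter_false {s P Q : List (Bool × ℕ)} (h : NF s P Q) :
    (s.filter fun p => p.1 = false) = P := by
  obtain ⟨rfl, hP, hQ⟩ := h
  rw [List.filter_append, List.filter_eq_self.2, List.filter_eq_nil_iff.2, List.append_nil]
  · intro a ha; simp [hQ a ha]
  · intro a ha; simp [hP a ha]

theorem NF.filter_true {s P Q : List (Bool × ℕ)} (h : NF s P Q) :
    (s.filter fun p => p.1 = true) = Q := by
  obtain ⟨rfl, hP, hQ⟩ := h
  rw [List.filter_append, List.filter_eq_nil_iff.2, List.filter_eq_self.2, List.nil_append]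
  · intro a ha; simp [hQ a ha]
  · intro a ha; simp [hP a ha]

theorem word_key (u v : List (Bool × ℕ)) (r : ℕ) (hu : ∀ c ∈ u, c.2 ≠ r) (hv : ∀ c ∈ v, c.2 ≠ r) :
    (((reduceWord (u ++ (false, r) :: v)).filter fun p => p.1 = false).getLast?).map Prod.snd = some r
    ↔ (((reduceWord (u ++ (true, r) :: v)).filter fun p => p.1 = true).head?).map Prod.snd = some r := by
  obtain ⟨P, Q, h1, h2⟩ := foldl_NF u (s := []) (P := []) (Q := []) ⟨rfl, by simp, by simp⟩
  have h2' : ∀ p ∈ P ++ Q, p.2 ≠ r := fun p hp => hu p (by simpa using h2 p hp)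
  obtain ⟨h1, hP, hQ⟩ := h1
  have start : GoodP r (cancelStep (P ++ Q) (true, r)) (cancelStep (P ++ Q) (false, r)) ∨
      (DeadM r (cancelStep (P ++ Q) (true, r)) ∧ DeadL r (cancelStep (P ++ Q) (false, r))) := by
    rcases snoc_true Q hQ with rfl | ⟨Q', j, rfl, hQ'⟩
    · left
      refine ⟨P, [], hP, by simp, by simp [cs_true], ?_⟩
      rw [List.append_nil, cs_false_nil P hP]
    · right
      constructor
      · refine ⟨P, Q' ++ [(true, j)] ++ [(true, r)], ⟨by simp [cs_true], hP, by grind⟩, ?_⟩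
        intro p hp
        apply h2'
        cases Q' <;> grind
      · refine ⟨P, Q', ⟨?_, hP, hQ'⟩, ?_⟩
        · rw [← List.append_assoc, cs_false_snoc]
        · intro p hp
          exact h2' p (by simp [List.mem_of_getLast? hp])
  have fin := rel_foldl v hv start
  unfold reduceWord
  rw [List.foldl_append, List.foldl_append, h1, List.foldl_cons, List.foldl_cons]
  rcases fin with ⟨P, Q, hP, hQ, e1, e2⟩ | ⟨⟨P, Q, hn, hd⟩, ⟨P', Q', hn', hd'⟩⟩
  · rw [e1, e2, NF.filter_false (P := P ++ [(false, r)]) (Q := Q) ⟨by simp, by grind, hQ⟩,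
      NF.filter_true (P := P) (Q := (true, r) :: Q) ⟨by simp, hP, by grind⟩]
    simp
  · rw [hn.filter_true, hn'.filter_false]
    constructor
    · intro h
      obtain ⟨a, ha, hb⟩ := Option.map_eq_some_iff.1 h
      exact absurd hb (hd' a ha)
    · intro h
      obtain ⟨a, ha, hb⟩ := Option.map_eq_some_iff.1 h
      exact absurd hb (hd a ha)

/-! cells -/

theorem isAddable_iff (μ : YoungDiagram) (r c : ℕ) : IsAddableCell μ (r, c) ↔
    (r, c) ∉ μ ∧ (∀ k, k + 1 = r → (k, c) ∈ μ) ∧ (∀ k, k + 1 = c → (r, k) ∈ μ) := by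
  constructor
  · rintro ⟨h1, h2⟩
    refine ⟨h1, ?_, ?_⟩
    · rintro k rfl
      have := h2 (a := (k+1, c)) (b := (k, c)) (by simp) (by simp)
      simpa using this
    · rintro k rfl
      have := h2 (a := (r, k+1)) (b := (r, k)) (by simp) (by simp)
      simpa using this
  · rintro ⟨h1, h2, h3⟩
    refine ⟨h1, ?_⟩
    rintro ⟨a, b⟩ ⟨a', b'⟩ hle hm
    obtain ⟨hle1, hle2⟩ := Prod.mk_le_mk.1 hle
    rcases hm with hm | hm
    · obtain ⟨rfl, rfl⟩ := Prod.mk.inj hm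
      rcases Nat.lt_or_eq_of_le hle1 with h | rfl
      · right
        obtain ⟨k, rfl⟩ : ∃ k, k + 1 = a := ⟨a - 1, by omega⟩
        exact μ.up_left_mem (by omega) hle2 (h2 k rfl)
      · rcases Nat.lt_or_eq_of_le hle2 with h | rfl
        · right
          obtain ⟨k, rfl⟩ : ∃ k, k + 1 = b := ⟨b - 1, by omega⟩
          exact μ.up_left_mem le_rfl (by omega) (h3 k rfl)
        · left; rfl
    · right
      exact μ.up_left_mem hle1 hle2 hm

theorem isRemovable_iff (μ : YoungDiagram) (r c : ℕ) : IsRemovableCell μ (r, c) ↔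
    (r, c) ∈ μ ∧ (r + 1, c) ∉ μ ∧ (r, c + 1) ∉ μ := by
  constructor
  · rintro ⟨h1, h2⟩
    refine ⟨h1, ?_, ?_⟩
    · intro h
      have := h2 (a := (r+1, c)) (b := (r, c)) (by simp) (by simpa using h)
      simp at this
    · intro h
      have := h2 (a := (r, c+1)) (b := (r, c)) (by simp) (by simpa using h)
      simp at this
  · rintro ⟨h1, h2, h3⟩
    refine ⟨h1, ?_⟩
    rintro ⟨a, b⟩ ⟨a', b'⟩ hle hm
    obtain ⟨hle1, hle2⟩ := Prod.mk_le_mk.1 hle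
    have hm' : (a, b) ≠ (r, c) ∧ (a, b) ∈ μ := by simpa [and_comm] using hm
    have : (a', b') ≠ (r, c) ∧ (a', b') ∈ μ := by
      refine ⟨?_, μ.up_left_mem hle1 hle2 hm'.2⟩
      intro he
      obtain ⟨rfl, rfl⟩ := Prod.mk.inj he
      rcases Nat.lt_or_eq_of_le hle1 with h | rfl
      · exact h2 (μ.up_left_mem (by omega) hle2 hm'.2)
      · rcases Nat.lt_or_eq_of_le hle2 with h | rfl
        · exact h3 (μ.up_left_mem le_rfl (by omega) hm'.2)
        · exact hm'.1 rfl
    simpa [and_comm] using this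

theorem addable_rowLen {μ : YoungDiagram} {r c : ℕ} (h : IsAddableCell μ (r, c)) :
    c = μ.rowLen r := by
  obtain ⟨h1, -, h3⟩ := (isAddable_iff μ r c).1 h
  rw [YoungDiagram.mem_iff_lt_rowLen] at h1
  rcases c with _ | k
  · omega
  · have := h3 k rfl
    rw [YoungDiagram.mem_iff_lt_rowLen] at this
    omega

theorem removable_rowLen {μ : YoungDiagram} {r c : ℕ} (h : IsRemovableCell μ (r, c)) :
    c = μ.rowLen r - 1 := by
  obtain ⟨h1, -, h3⟩ := (isRemovable_iff μ r c).1 h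
  rw [YoungDiagram.mem_iff_lt_rowLen] at h1 h3
  omega

theorem mem_lt_card {μ : YoungDiagram} {r c : ℕ} (h : (r, c) ∈ μ) :
    r < μ.cells.card ∧ c < μ.cells.card := by
  constructor
  · have : ((Finset.range (r+1)).image fun k => (k, c)) ⊆ μ.cells := by
      intro x hx
      simp only [Finset.mem_image, Finset.mem_range] at hx
      obtain ⟨k, hk, rfl⟩ := hx
      exact μ.up_left_mem (by omega) le_rfl h
    have := Finset.card_le_card this
    rw [Finset.card_image_of_injective _ (fun a b h => (Prod.mk.inj h).1)] at this
    simpa using this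
  · have : ((Finset.range (c+1)).image fun k => (r, k)) ⊆ μ.cells := by
      intro x hx
      simp only [Finset.mem_image, Finset.mem_range] at hx
      obtain ⟨k, hk, rfl⟩ := hx
      exact μ.up_left_mem le_rfl (by omega) h
    have := Finset.card_le_card this
    rw [Finset.card_image_of_injective _ (fun a b h => (Prod.mk.inj h).2)] at this
    simpa using this

theorem mem_addables (i : ZMod ℓ) (μ : YoungDiagram) (x : ℕ × ℕ) :
    x ∈ addables ℓ i μ ↔ IsAddableCell μ x ∧ res ℓ x = i := by
  obtain ⟨r, c⟩ := x
  unfold addables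
  rw [Finset.mem_filter, Finset.mem_product, Finset.mem_range, Finset.mem_range]
  refine ⟨fun h => h.2, fun h => ⟨?_, h⟩⟩
  obtain ⟨-, h2, h3⟩ := (isAddable_iff μ r c).1 h.1
  constructor
  · rcases r with _ | k
    · simp
    · have := (mem_lt_card (h2 k rfl)).1
      simpa using this
  · rcases c with _ | k
    · simp
    · have := (mem_lt_card (h3 k rfl)).2
      simpa using this

theorem mem_removables (i : ZMod ℓ) (μ : YoungDiagram) (x : ℕ × ℕ) :
    x ∈ removables ℓ i μ ↔ IsRemovableCell μ x ∧ res ℓ x = i := by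
  unfold removables
  rw [Finset.mem_filter]
  exact ⟨fun h => h.2, fun h => ⟨h.1.1, h⟩⟩

theorem rowLetter_big (i : ZMod ℓ) (μ : YoungDiagram) (r : ℕ) (h : μ.cells.card < r) :
    rowLetter ℓ i μ r = none := by
  unfold rowLetter
  rw [if_neg, if_neg]
  · rintro ⟨c, hc⟩
    have := (mem_lt_card ((mem_removables ℓ i μ _).1 hc).1.1).1
    omega
  · rintro ⟨c, hc⟩
    simp [addables] at hc
    omega

theorem wordP_eq (i : ZMod ℓ) (μ : YoungDiagram) (d : ℕ) :
    wordP ℓ i μ = rwf (rowLetter ℓ i μ) (List.range (μ.cells.card + 2 + d)).reverse := by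
  induction d with
  | zero => rfl
  | succ d ih =>
    rw [ih, ← Nat.add_assoc, List.range_succ, List.reverse_append]
    unfold rwf
    simp [rowLetter_big ℓ i μ (μ.cells.card + 2 + d) (by omega)]

theorem res_ne {ℓ : ℕ} (hℓ : 2 ≤ ℓ) (m n : ℤ) (h : m = n + 1) : ((m : ℤ) : ZMod ℓ) ≠ ((n : ℤ) : ZMod ℓ) := by
  subst h
  haveI : Fact (1 < ℓ) := ⟨by omega⟩
  push_cast
  simp

theorem key (hℓ : 2 ≤ ℓ) (lam mu : YoungDiagram) (i : ZMod ℓ) (r c : ℕ)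
    (hx : (r, c) ∉ mu) (hc : lam.cells = insert (r, c) mu.cells) (hr : res ℓ (r, c) = i) :
    goodRow ℓ i lam = some r ↔ cogoodRow ℓ i mu = some r := by
  have hmem : ∀ y, y ∈ lam ↔ y = (r, c) ∨ y ∈ mu := by
    intro y
    rw [← YoungDiagram.mem_cells, hc, Finset.mem_insert, YoungDiagram.mem_cells]
  have hxl : (r, c) ∈ lam := (hmem _).2 (Or.inl rfl)
  have ha : IsAddableCell mu (r, c) := by
    refine ⟨hx, ?_⟩
    have := lam.isLowerSet
    rw [hc] at this
    simpa using this
  have hrem : IsRemovableCell lam (r, c) := by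
    refine ⟨hxl, ?_⟩
    rw [hc, Finset.erase_insert (by simpa using hx)]
    exact mu.isLowerSet
  -- neighbours
  have hmem' : ∀ a b a' b' : ℕ, res ℓ (a, b) = i →
      ((a' : ℤ) + b = a + b' + 1 ∨ (a : ℤ) + b' = a' + b + 1) → ((a', b') ∈ lam ↔ (a', b') ∈ mu) := by
    intro a b a' b' h1 h2
    rw [hmem, or_iff_right]
    intro he
    obtain ⟨rfl, rfl⟩ := Prod.mk.inj he
    rw [← hr] at h1
    unfold res at h1
    rcases h2 with h2 | h2
    · exact res_ne hℓ _ _ (by simp only; omega) h1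
    · exact res_ne hℓ _ _ (by simp only; omega) h1.symm
  have hadd : ∀ y, y ∈ addables ℓ i lam ↔ y ∈ addables ℓ i mu ∧ y ≠ (r, c) := by
    rintro ⟨a, b⟩
    rw [mem_addables, mem_addables, isAddable_iff, isAddable_iff]
    by_cases hi : res ℓ (a, b) = i
    · have e1 : (∀ k, k + 1 = a → (k, b) ∈ lam) ↔ (∀ k, k + 1 = a → (k, b) ∈ mu) :=
        forall_congr' fun k => imp_congr_right fun hk => hmem' a b k b hi (by omega)
      have e2 : (∀ k, k + 1 = b → (a, k) ∈ lam) ↔ (∀ k, k + 1 = b → (a, k) ∈ mu) :=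
        forall_congr' fun k => imp_congr_right fun hk => hmem' a b a k hi (by omega)
      rw [e1, e2, hmem]
      tauto
    · tauto
  have hremv : ∀ y, y ∈ removables ℓ i lam ↔ y ∈ removables ℓ i mu ∨ y = (r, c) := by
    rintro ⟨a, b⟩
    by_cases hy : (a, b) = (r, c)
    · rw [hy]
      simp only [or_true, iff_true]
      exact (mem_removables ℓ i lam _).2 ⟨hrem, hr⟩
    rw [mem_removables, mem_removables, isRemovable_iff, isRemovable_iff]
    by_cases hi : res ℓ (a, b) = i
    · rw [hmem' a b (a+1) b hi (by push_cast; omega), hmem' a b a (b+1) hi (by push_cast; omega), hmem]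
      tauto
    · tauto
  have hlm : rowLetter ℓ i mu r = some true := by
    unfold rowLetter
    rw [if_pos ⟨c, (mem_addables ℓ i mu _).2 ⟨ha, hr⟩⟩]
  have hll : rowLetter ℓ i lam r = some false := by
    unfold rowLetter
    rw [if_neg, if_pos ⟨c, (mem_removables ℓ i lam _).2 ⟨hrem, hr⟩⟩]
    rintro ⟨b, hb⟩
    obtain ⟨h1, h2⟩ := (hadd _).1 hb
    apply h2
    rw [addable_rowLen ((mem_addables ℓ i mu _).1 h1).1, ← addable_rowLen ha]
  have hne : ∀ a, a ≠ r → rowLetter ℓ i lam a = rowLetter ℓ i mu a := by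
    intro a hne
    have e1 : (∃ b, (a, b) ∈ addables ℓ i lam) ↔ (∃ b, (a, b) ∈ addables ℓ i mu) := by
      refine exists_congr fun b => ?_
      rw [hadd]
      simp [hne]
    have e2 : (∃ b, (a, b) ∈ removables ℓ i lam) ↔ (∃ b, (a, b) ∈ removables ℓ i mu) := by
      refine exists_congr fun b => ?_
      rw [hremv]
      simp [hne]
    unfold rowLetter
    simp only [e1, e2]
  have hcard : lam.cells.card = mu.cells.card + 1 := by
    rw [hc, Finset.card_insert_of_notMem (by simpa using hx)]
  have hrlt : r < mu.cells.card + 2 + 1 := by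
    have := (mem_lt_card hxl).1
    omega
  have wl : wordP ℓ i lam = rwf (rowLetter ℓ i lam) (List.range (mu.cells.card + 2 + 1)).reverse := by
    rw [wordP_eq ℓ i lam 0, hcard]
  have wm := wordP_eq ℓ i mu 1
  have hin : r ∈ (List.range (mu.cells.card + 2 + 1)).reverse := by simpa using hrlt
  have hnd : (List.range (mu.cells.card + 2 + 1)).reverse.Nodup :=
    List.nodup_reverse.2 List.nodup_range
  obtain ⟨U, V, hUV⟩ := List.append_of_mem hin
  rw [hUV] at hnd wl wm
  have hU : r ∉ U := by
    intro h
    exact (List.disjoint_of_nodup_append hnd) h (by simp)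
  have hV : r ∉ V := by
    have := (List.nodup_append.1 hnd).2.1
    exact (List.nodup_cons.1 this).1
  have hcongr : ∀ L : List ℕ, r ∉ L → rwf (rowLetter ℓ i lam) L = rwf (rowLetter ℓ i mu) L := by
    intro L hL
    unfold rwf
    refine List.filterMap_congr fun a ha => ?_
    rw [hne a (fun h => hL (h ▸ ha))]
  have hrows : ∀ L : List ℕ, r ∉ L → ∀ p ∈ rwf (rowLetter ℓ i mu) L, p.2 ≠ r := by
    intro L hL p hp
    unfold rwf at hp
    rw [List.mem_filterMap] at hp
    obtain ⟨a, ha, hp⟩ := hp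
    obtain ⟨b, -, rfl⟩ := Option.map_eq_some_iff.1 hp
    exact fun h => hL (h ▸ ha)
  have wl' : wordP ℓ i lam = rwf (rowLetter ℓ i mu) U ++ (false, r) :: rwf (rowLetter ℓ i mu) V := by
    rw [wl, ← hcongr U hU, ← hcongr V hV]
    simp [rwf, hll]
  have wm' : wordP ℓ i mu = rwf (rowLetter ℓ i mu) U ++ (true, r) :: rwf (rowLetter ℓ i mu) V := by
    rw [wm]
    simp [rwf, hlm]
  unfold goodRow cogoodRow
  rw [wl', wm']
  exact word_key _ _ r (hrows U hU) (hrows V hV)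

theorem mem_wordP {i : ZMod ℓ} {μ : YoungDiagram} {b : Bool} {r : ℕ} (h : (b, r) ∈ wordP ℓ i μ) :
    rowLetter ℓ i μ r = some b := by
  unfold wordP at h
  rw [List.mem_filterMap] at h
  obtain ⟨a, -, h⟩ := h
  obtain ⟨b', h1, h2⟩ := Option.map_eq_some_iff.1 h
  obtain ⟨rfl, rfl⟩ := Prod.mk.inj h2
  exact h1

theorem goodRow_spec {i : ZMod ℓ} {μ : YoungDiagram} {r : ℕ} (h : goodRow ℓ i μ = some r) :
    IsRemovableCell μ (r, μ.rowLen r - 1) ∧ res ℓ (r, μ.rowLen r - 1) = i := by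
  unfold goodRow at h
  obtain ⟨⟨b, a⟩, h1, rfl⟩ := Option.map_eq_some_iff.1 h
  have h2 := List.mem_filter.1 (List.mem_of_getLast? h1)
  have h3 : b = false := by simpa using h2.2
  subst h3
  have h4 := mem_wordP ℓ (mem_reduce h2.1)
  unfold rowLetter at h4
  split_ifs at h4 with h5 h6
  · simp at h4
  · obtain ⟨c, hc⟩ := h6
    have hc := (mem_removables ℓ i μ _).1 hc
    have := removable_rowLen hc.1
    subst this
    exact hc

theorem cogoodRow_spec {i : ZMod ℓ} {μ : YoungDiagram} {r : ℕ} (h : cogoodRow ℓ i μ = some r) :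
    IsAddableCell μ (r, μ.rowLen r) ∧ res ℓ (r, μ.rowLen r) = i := by
  unfold cogoodRow at h
  obtain ⟨⟨b, a⟩, h1, rfl⟩ := Option.map_eq_some_iff.1 h
  have h2 := List.mem_filter.1 (List.mem_of_head? h1)
  have h3 : b = true := by simpa using h2.2
  subst h3
  have h4 := mem_wordP ℓ (mem_reduce h2.1)
  unfold rowLetter at h4
  split_ifs at h4 with h5 h6
  · obtain ⟨c, hc⟩ := h5
    have hc := (mem_addables ℓ i μ _).1 hc
    have := addable_rowLen hc.1
    subst this
    exact hc
  · simp at h4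

theorem eraseCell_cells {μ : YoungDiagram} {x : ℕ × ℕ} (h : IsRemovableCell μ x) :
    (eraseCell μ x).cells = μ.cells.erase x := by
  unfold eraseCell
  rw [dif_pos h.2]

theorem addCell_cells {μ : YoungDiagram} {x : ℕ × ℕ} (h : IsAddableCell μ x) :
    (addCell μ x).cells = insert x μ.cells := by
  unfold addCell
  rw [dif_pos h.2]

/-- Misra–Miwa crystal of the Fock space, combinatorial form.
For all partitions `λ, μ` and every residue `i ∈ ℤ/ℓ`: `ẽᵢ λ = μ` if and only if
`f̃ᵢ μ = λ`.  In particular `ẽᵢ` and `f̃ᵢ` are mutually inverse partial bijections on the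
set of partitions. -/
theorem statement11 (hℓ : 2 ≤ ℓ) :
    ∀ (lam mu : YoungDiagram) (i : ZMod ℓ),
      etilde ℓ i lam = some mu ↔ ftilde ℓ i mu = some lam := by
  intro lam mu i
  unfold etilde ftilde
  constructor
  · intro h
    obtain ⟨r, hg, rfl⟩ := Option.map_eq_some_iff.1 h
    obtain ⟨h1, h2⟩ := goodRow_spec ℓ hg
    have hcells := eraseCell_cells h1
    have hins : lam.cells = insert (r, lam.rowLen r - 1) (eraseCell lam (r, lam.rowLen r - 1)).cells := by
      rw [hcells, Finset.insert_erase]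
      exact h1.1
    have hx : (r, lam.rowLen r - 1) ∉ eraseCell lam (r, lam.rowLen r - 1) := by
      rw [← YoungDiagram.mem_cells, hcells]
      simp
    generalize hc : lam.rowLen r - 1 = c at *
    generalize eraseCell lam (r, c) = mu at *
    have hg' := (key ℓ hℓ lam mu i r c hx hins h2).1 hg
    have ha : IsAddableCell mu (r, c) := by
      refine ⟨hx, ?_⟩
      have := lam.isLowerSet
      rw [hins] at this
      simpa using this
    rw [hg', Option.map_some, ← addable_rowLen ha]
    congr 1
    apply YoungDiagram.ext
    rw [addCell_cells ha, hins]
  · intro h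
    obtain ⟨r, hg, rfl⟩ := Option.map_eq_some_iff.1 h
    obtain ⟨h1, h2⟩ := cogoodRow_spec ℓ hg
    have hcells := addCell_cells h1
    generalize hc : mu.rowLen r = c at *
    generalize addCell mu (r, c) = lam at *
    have hg' := (key ℓ hℓ lam mu i r c h1.1 hcells h2).2 hg
    have hnm : (r, c) ∉ mu.cells := h1.1
    have ha : IsRemovableCell lam (r, c) := by
      refine ⟨?_, ?_⟩
      · rw [← YoungDiagram.mem_cells, hcells]; simp
      · rw [hcells, Finset.erase_insert hnm]
        exact mu.isLowerSet
    rw [hg', Option.map_some, ← removable_rowLen ha]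
    congr 1
    apply YoungDiagram.ext
    rw [eraseCell_cells ha, hcells, Finset.erase_insert hnm]

end FockCrystal
end
end
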